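/- arXiv:2509.15647 — 2 statements merged into one kernel-verified Lean document; each statement's English description precedes it below -/
import Mathlib

section
/- Let (R_n)_{n≥1} be an aperiodic renewal sequence of operators on the complex Banach space 𝓑, let β ∈ (0,1) and let L : ℕ → (0,∞) be slowly varying. Assume that (n^{1+β}/L(n))·R_n converges in operator norm to a bounded operator E, and that Σ_{j>n} r_j ∼ L(n)/n^β as n → ∞. Then there exists a constant C > 0 such that for all n ≥ 1 and ℓ ≥ 1, the operator norm of R_n^{(ℓ)} satisfies ‖R_n^{(ℓ)}‖ ≤ C·ℓ²·L(n)/n^{1+β}. -/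
open Filter

noncomputable section

/-- `opIter R ℓ n` is the operator `R_n^{(ℓ)} = Σ_{j₁+⋯+j_ℓ = n} R_{j₁} ∘ ⋯ ∘ R_{j_ℓ}`
(sum over `ℓ`-tuples of positive integers, which is achieved here by requiring `R 0 = 0`);
by convention `R_n^{(0)}` is the identity if `n = 0` and `0` otherwise. -/
def opIter {B : Type*} [NormedAddCommGroup B] [NormedSpace ℂ B]
    (R : ℕ → B →L[ℂ] B) : ℕ → ℕ → (B →L[ℂ] B)
  | 0, n => if n = 0 then 1 else 0
  | ℓ + 1, n => ∑ k ∈ Finset.range (n + 1), (opIter R ℓ k).comp (R (n - k))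

/-- `L : ℕ → (0, ∞)` is slowly varying if `L(⌊c n⌋)/L(n) → 1` for every `c > 0`. -/
def SlowlyVaryingSeq (L : ℕ → ℝ) : Prop :=
  (∀ n, 0 < L n) ∧ ∀ c : ℝ, 0 < c →
    Tendsto (fun n : ℕ => L (Nat.floor (c * n)) / L n) atTop (nhds 1)

section WienerBound

/-- The character `t ↦ exp (2πint)` of the circle, seen as a function on `ℝ`. -/
def chr (n : ℤ) (t : ℝ) : ℂ := Complex.exp (2 * Real.pi * Complex.I * n * t)

lemma chr_zero (t : ℝ) : chr 0 t = 1 := by simp [chr]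

lemma chr_at_zero (n : ℤ) : chr n 0 = 1 := by simp [chr]

lemma chr_add (m n : ℤ) (t : ℝ) : chr (m + n) t = chr m t * chr n t := by
  simp only [chr, ← Complex.exp_add]
  congr 1
  push_cast
  ring

lemma chr_add_right (n : ℤ) (s t : ℝ) : chr n (s + t) = chr n s * chr n t := by
  simp only [chr, ← Complex.exp_add]
  congr 1
  push_cast
  ring

lemma chr_natCast (n : ℕ) (t : ℝ) : chr n t = chr 1 t ^ n := by
  simp only [chr, ← Complex.exp_nat_mul]
  congr 1
  push_cast
  ring

lemma norm_chr (n : ℤ) (t : ℝ) : ‖chr n t‖ = 1 := by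
  have h : (2 * Real.pi * Complex.I * n * t : ℂ) = ((2 * Real.pi * n * t : ℝ) : ℂ) * Complex.I := by
    push_cast
    ring
  rw [chr, h, Complex.norm_exp_ofReal_mul_I]

lemma continuous_chr (n : ℤ) : Continuous (chr n) := by
  unfold chr
  fun_prop

variable {E : Type*} [NormedAddCommGroup E] [NormedSpace ℂ E]
variable {A : Type*} [NormedRing A] [NormedAlgebra ℂ A]

/-- `F` is the sum of a trigonometric series whose coefficients have norms summing to at most
`K`. -/
def WienerBound (F : ℝ → E) (K : ℝ) : Prop :=
  ∃ (ι : Type) (ν : ι → ℤ) (f : ι → E), (Summable fun i => ‖f i‖) ∧ ∑' i, ‖f i‖ ≤ K ∧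
    ∀ t, HasSum (fun i => chr (ν i) t • f i) (F t)

lemma WienerBound.mono {F : ℝ → E} {K K' : ℝ} (h : WienerBound F K) (hK : K ≤ K') :
    WienerBound F K' := by
  obtain ⟨ι, ν, f, h1, h2, h3⟩ := h
  exact ⟨ι, ν, f, h1, h2.trans hK, h3⟩

lemma WienerBound.congr {F G : ℝ → E} {K : ℝ} (h : WienerBound F K) (hFG : ∀ t, F t = G t) :
    WienerBound G K := by
  rwa [← (funext hFG : F = G)]

lemma WienerBound.nonneg {F : ℝ → E} {K : ℝ} (h : WienerBound F K) : 0 ≤ K := by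
  obtain ⟨ι, ν, f, h1, h2, h3⟩ := h
  exact (tsum_nonneg fun i => norm_nonneg _).trans h2

lemma WienerBound.add {F G : ℝ → E} {K K' : ℝ} (hF : WienerBound F K) (hG : WienerBound G K') :
    WienerBound (fun t => F t + G t) (K + K') := by
  obtain ⟨ι, ν, f, h1, h2, h3⟩ := hF
  obtain ⟨κ, μ, g, h1', h2', h3'⟩ := hG
  have hs : HasSum (fun i => ‖Sum.elim f g i‖) (∑' i, ‖f i‖ + ∑' i, ‖g i‖) :=
    HasSum.sum (f := fun i => ‖Sum.elim f g i‖) h1.hasSum h1'.hasSum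
  refine ⟨ι ⊕ κ, Sum.elim ν μ, Sum.elim f g, hs.summable, ?_, fun t => ?_⟩
  · rw [hs.tsum_eq]
    exact add_le_add h2 h2'
  · exact HasSum.sum (f := fun i => chr (Sum.elim ν μ i) t • Sum.elim f g i) (h3 t) (h3' t)

lemma wienerBound_chr_smul (n : ℤ) (a : E) : WienerBound (fun t => chr n t • a) ‖a‖ := by
  refine ⟨Unit, fun _ => n, fun _ => a, (hasSum_fintype _).summable, ?_, fun t => ?_⟩
  · simp
  · simp

lemma wienerBound_const (a : E) : WienerBound (fun _ => a) ‖a‖ :=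
  (wienerBound_chr_smul 0 a).congr fun t => by rw [chr_zero, one_smul]

lemma wienerBound_chr (n : ℤ) : WienerBound (chr n) 1 := by
  have h := wienerBound_chr_smul n (1 : ℂ)
  rw [norm_one] at h
  exact h.congr fun t => by simp

lemma WienerBound.smul [CompleteSpace E] {φ : ℝ → ℂ} {F : ℝ → E} {K K' : ℝ}
    (hφ : WienerBound φ K) (hF : WienerBound F K') :
    WienerBound (fun t => φ t • F t) (K * K') := by
  have hK := hφ.nonneg
  obtain ⟨ι, ν, f, h1, h2, h3⟩ := hφ
  obtain ⟨κ, μ, g, h1', h2', h3'⟩ := hF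
  have hs : Summable fun x : ι × κ => ‖f x.1‖ * ‖g x.2‖ :=
    h1.mul_of_nonneg h1' (fun _ => norm_nonneg _) (fun _ => norm_nonneg _)
  refine ⟨ι × κ, fun x => ν x.1 + μ x.2, fun x => f x.1 • g x.2, ?_, ?_, fun t => ?_⟩
  · simpa only [norm_smul] using hs
  · simp only [norm_smul]
    rw [← h1.tsum_mul_tsum h1' hs]
    exact mul_le_mul h2 h2' (tsum_nonneg fun _ => norm_nonneg _) hK
  · have hs' : Summable fun x : ι × κ => (chr (ν x.1) t • f x.1) • (chr (μ x.2) t • g x.2) := by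
      refine Summable.of_norm ?_
      simpa only [norm_smul, norm_mul, smul_eq_mul, norm_chr, one_mul] using hs
    refine ((h3 t).smul (h3' t) hs').congr_fun fun x => ?_
    rw [chr_add, smul_smul, smul_smul, smul_eq_mul]
    ring_nf

lemma WienerBound.mul [CompleteSpace A] {F G : ℝ → A} {K K' : ℝ}
    (hF : WienerBound F K) (hG : WienerBound G K') :
    WienerBound (fun t => F t * G t) (K * K') := by
  have hK := hF.nonneg
  obtain ⟨ι, ν, f, h1, h2, h3⟩ := hF
  obtain ⟨κ, μ, g, h1', h2', h3'⟩ := hG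
  have hs : Summable fun x : ι × κ => ‖f x.1‖ * ‖g x.2‖ :=
    h1.mul_of_nonneg h1' (fun _ => norm_nonneg _) (fun _ => norm_nonneg _)
  have hs2 : Summable fun x : ι × κ => ‖f x.1 * g x.2‖ :=
    hs.of_nonneg_of_le (fun _ => norm_nonneg _) fun _ => norm_mul_le _ _
  refine ⟨ι × κ, fun x => ν x.1 + μ x.2, fun x => f x.1 * g x.2, hs2, ?_, fun t => ?_⟩
  · refine (hs2.tsum_le_tsum (fun x => norm_mul_le _ _) hs).trans ?_
    rw [← h1.tsum_mul_tsum h1' hs]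
    exact mul_le_mul h2 h2' (tsum_nonneg fun _ => norm_nonneg _) hK
  · have hs' : Summable fun x : ι × κ => (chr (ν x.1) t • f x.1) * (chr (μ x.2) t • g x.2) := by
      refine Summable.of_norm ?_
      simpa only [smul_mul_smul_comm, norm_smul, norm_mul, norm_chr, one_mul] using hs2
    refine ((h3 t).mul (h3' t) hs').congr_fun fun x => ?_
    rw [chr_add, smul_mul_smul_comm]

lemma WienerBound.const_smul [CompleteSpace E] {F : ℝ → E} {K : ℝ} (c : ℂ)
    (hF : WienerBound F K) : WienerBound (fun t => c • F t) (‖c‖ * K) :=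
  (wienerBound_const c).smul hF

lemma WienerBound.neg [CompleteSpace E] {F : ℝ → E} {K : ℝ}
    (hF : WienerBound F K) : WienerBound (fun t => -F t) K := by
  have h := hF.const_smul (-1)
  rw [norm_neg, norm_one, one_mul] at h
  exact h.congr fun t => by simp

lemma WienerBound.sub [CompleteSpace E] {F G : ℝ → E} {K K' : ℝ} (hF : WienerBound F K)
    (hG : WienerBound G K') : WienerBound (fun t => F t - G t) (K + K') :=
  (hF.add hG.neg).congr fun _ => (sub_eq_add_neg _ _).symm

lemma WienerBound.sum {κ : Type*} (s : Finset κ) {F : κ → ℝ → E} {K : κ → ℝ}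
    (h : ∀ k ∈ s, WienerBound (F k) (K k)) :
    WienerBound (fun t => ∑ k ∈ s, F k t) (∑ k ∈ s, K k) := by
  classical
  induction s using Finset.induction_on with
  | empty =>
    have h0 := wienerBound_const (0 : E)
    rw [norm_zero] at h0
    simpa using h0
  | insert a s ha ih =>
    simp only [Finset.sum_insert ha]
    exact (h a (Finset.mem_insert_self a s)).add
      (ih fun k hk => h k (Finset.mem_insert_of_mem hk))

lemma WienerBound.pow [CompleteSpace A] [NormOneClass A] {F : ℝ → A} {K : ℝ}
    (hF : WienerBound F K) (n : ℕ) : WienerBound (fun t => F t ^ n) (K ^ n) := by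
  induction n with
  | zero =>
    have h := wienerBound_const (1 : A)
    rw [norm_one] at h
    simpa using h
  | succ n ih => simpa only [pow_succ] using ih.mul hF

lemma WienerBound.translate {F : ℝ → E} {K : ℝ} (hF : WienerBound F K) (s : ℝ) :
    WienerBound (fun t => F (t + s)) K := by
  obtain ⟨ι, ν, f, h1, h2, h3⟩ := hF
  refine ⟨ι, ν, fun i => chr (ν i) s • f i, ?_, ?_, fun t => ?_⟩
  · simpa only [norm_smul, norm_chr, one_mul] using h1
  · simpa only [norm_smul, norm_chr, one_mul] using h2
  · refine (h3 (t + s)).congr_fun fun i => ?_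
    rw [chr_add_right, smul_smul]

lemma hasSum_chr_smul [CompleteSpace E] {ι : Type*} (ν : ι → ℤ) {f : ι → E}
    (hf : Summable fun i => ‖f i‖) (t : ℝ) :
    HasSum (fun i => chr (ν i) t • f i) (∑' i, chr (ν i) t • f i) := by
  refine (Summable.of_norm ?_).hasSum
  simpa only [norm_smul, norm_chr, one_mul] using hf

lemma wienerBound_tsum [CompleteSpace E] {ι : Type} (ν : ι → ℤ) {f : ι → E}
    (hf : Summable fun i => ‖f i‖) :
    WienerBound (fun t => ∑' i, chr (ν i) t • f i) (∑' i, ‖f i‖) :=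
  ⟨ι, ν, f, hf, le_rfl, hasSum_chr_smul ν hf⟩

lemma integral_chr (n : ℤ) : ∫ t in (0 : ℝ)..1, chr n t = if n = 0 then 1 else 0 := by
  split_ifs with h
  · simp [h, chr_zero]
  · have hc : (2 * Real.pi * Complex.I * n : ℂ) ≠ 0 := by
      simp [h, Real.pi_ne_zero]
    have := integral_exp_mul_complex (a := 0) (b := 1) hc
    simp only [chr]
    rw [this]
    have h1 : Complex.exp (2 * Real.pi * Complex.I * n * (1 : ℝ)) = 1 := by
      rw [Complex.exp_eq_one_iff]
      exact ⟨n, by push_cast; ring⟩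
    rw [h1]
    simp

/-- The Fourier coefficients of an absolutely convergent trigonometric series. -/
lemma hasSum_fourierCoeff_aux [CompleteSpace E] {ι : Type} [Countable ι] {ν : ι → ℤ} {f : ι → E}
    {F : ℝ → E} (hf : Summable fun i => ‖f i‖)
    (hF : ∀ t, HasSum (fun i => chr (ν i) t • f i) (F t)) (n : ℤ) :
    HasSum (fun i => if ν i = n then f i else 0) (∫ t in (0 : ℝ)..1, chr (-n) t • F t) := by
  let g : ι → C(ℝ, E) := fun i =>
    ⟨fun t => chr (ν i - n) t • f i, (continuous_chr _).smul continuous_const⟩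
  have hg : ∀ i t, g i t = chr (-n) t • chr (ν i) t • f i := fun i t => by
    rw [smul_smul, ← chr_add, neg_add_eq_sub]
    rfl
  have hs := intervalIntegral.hasSum_intervalIntegral_of_summable_norm (a := 0) (b := 1)
    (f := g) (by
    refine hf.of_nonneg_of_le (fun _ => norm_nonneg _) fun i => ?_
    rw [ContinuousMap.norm_le _ (norm_nonneg _)]
    intro x
    change ‖chr (ν i - n) x • f i‖ ≤ _
    rw [norm_smul, norm_chr, one_mul])
  have h1 : ∀ t, ∑' i, g i t = chr (-n) t • F t := fun t => by
    simp only [hg]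
    exact ((hF t).const_smul _).tsum_eq
  simp only [h1] at hs
  refine hs.congr_fun fun i => ?_
  change _ = ∫ x in (0 : ℝ)..1, chr (ν i - n) x • f i
  rw [intervalIntegral.integral_smul_const, integral_chr]
  simp only [sub_eq_zero]
  split_ifs <;> simp

lemma WienerBound.sum_norm_integral_le [CompleteSpace E] {F : ℝ → E} {K : ℝ}
    (hF : WienerBound F K) (s : Finset ℤ) :
    ∑ n ∈ s, ‖∫ t in (0 : ℝ)..1, chr (-n) t • F t‖ ≤ K := by
  obtain ⟨ι, ν, f, h1, h2, h3⟩ := hF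
  refine le_trans ?_ h2
  let S := Function.support f
  have hS : S.Countable := by
    have := h1.countable_support
    rwa [show (Function.support fun i => ‖f i‖) = S from by ext i; simp [S]] at this
  have := hS.to_subtype
  have h1' : Summable fun i : S => ‖f i‖ := h1.subtype S
  have h3' : ∀ t, HasSum (fun i : S => chr (ν i) t • f i) (F t) := fun t => by
    refine (hasSum_subtype_iff_of_support_subset (f := fun i => chr (ν i) t • f i) ?_).2 (h3 t)
    intro i hi
    rw [Function.mem_support] at hi ⊢
    exact fun h => hi (by rw [h, smul_zero])
  have key : ∀ n ∈ s, ‖∫ t in (0 : ℝ)..1, chr (-n) t • F t‖ ≤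
      ∑' i : S, if ν i = n then ‖f i‖ else 0 := fun n _ => by
    rw [← (hasSum_fourierCoeff_aux h1' h3' n).tsum_eq]
    refine (norm_tsum_le_tsum_norm ?_).trans (le_of_eq ?_)
    · refine h1'.of_nonneg_of_le (fun _ => norm_nonneg _) fun i => ?_
      split_ifs <;> simp
    · congr 1
      ext i
      split_ifs <;> simp
  have hsum : ∀ n ∈ s, Summable fun i : S => if ν i = n then ‖f i‖ else 0 := fun n _ => by
    refine h1'.of_nonneg_of_le (fun i => ?_) fun i => ?_ <;> split_ifs <;> simp
  refine (Finset.sum_le_sum key).trans ?_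
  rw [← Summable.tsum_finsetSum hsum]
  refine ((summable_sum hsum).tsum_le_tsum (fun i => ?_) h1').trans
    (h1.tsum_subtype_le _ _ (fun i => norm_nonneg _))
  rw [Finset.sum_ite_eq]
  split_ifs <;> simp

end WienerBound

section Cutoff

lemma abs_sinc_sub_le (x y : ℝ) : |Real.sinc x - Real.sinc y| ≤ |x - y| := by
  have h : ∀ x : ℝ, Real.sinc x = ∫ s in (0 : ℝ)..1, Real.cos (s * x) := fun x => by
    by_cases hx : x = 0
    · simp [hx]
    · rw [intervalIntegral.integral_comp_mul_right _ hx, integral_cos, Real.sinc_of_ne_zero hx]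
      simp [div_eq_inv_mul]
  have hi : ∀ x : ℝ, IntervalIntegrable (fun s => Real.cos (s * x)) MeasureTheory.volume 0 1 :=
    fun x => (by fun_prop : Continuous fun s : ℝ => Real.cos (s * x)).intervalIntegrable _ _
  rw [h, h, ← intervalIntegral.integral_sub (hi x) (hi y), ← Real.norm_eq_abs]
  refine (intervalIntegral.norm_integral_le_of_norm_le_const (C := |x - y|) ?_).trans (by simp)
  intro s hs
  rw [Set.uIoc_of_le zero_le_one] at hs
  rw [Real.norm_eq_abs]
  have hL := Real.lipschitzWith_cos.dist_le_mul (s * x) (s * y)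
  rw [Real.dist_eq, Real.dist_eq, ← mul_sub, abs_mul, abs_of_pos hs.1] at hL
  refine hL.trans ?_
  simp only [NNReal.coe_one, one_mul]
  exact mul_le_of_le_one_left (abs_nonneg _) hs.2

/-- The Fourier coefficients of the hat function of width `h`. -/
def hatCoeff (h : ℝ) (n : ℤ) : ℝ := h * Real.sinc (Real.pi * n * h) ^ 2

/-- The `1`-periodic hat function of width `h`, as the sum of its Fourier series. -/
def hat (h : ℝ) (t : ℝ) : ℂ := ∑' n : ℤ, chr n t • (hatCoeff h n : ℂ)

lemma hatCoeff_nonneg {h : ℝ} (hh : 0 ≤ h) (n : ℤ) : 0 ≤ hatCoeff h n := by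
  unfold hatCoeff; positivity

lemma chr_add_intCast (n k : ℤ) (t : ℝ) : chr n (t + k) = chr n t := by
  rw [chr_add_right]
  have : chr n k = 1 := by
    rw [chr, Complex.exp_eq_one_iff]
    exact ⟨n * k, by push_cast; ring⟩
  rw [this, mul_one]

lemma hasSum_chr_div_sq {x t : ℝ} (hx : x ∈ Set.Icc (0 : ℝ) 1) (k : ℤ) (hk : x = t + k) :
    HasSum (fun n : ℤ => 1 / (n : ℂ) ^ 2 * chr n t)
      (2 * Real.pi ^ 2 * ((x ^ 2 - x + 6⁻¹ : ℝ) : ℂ)) := by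
  have h := hasSum_one_div_pow_mul_fourier_mul_bernoulliFun le_rfl hx
  have e : (-(2 * Real.pi * Complex.I) ^ 2 / (2).factorial * bernoulliFun 2 x : ℂ) =
      2 * Real.pi ^ 2 * ((x ^ 2 - x + 6⁻¹ : ℝ) : ℂ) := by
    rw [bernoulliFun_two, mul_pow, Complex.I_sq]
    simp only [Nat.factorial_two]
    push_cast
    ring
  rw [e] at h
  refine h.congr_fun fun n => ?_
  rw [fourier_coe_apply, ← chr_add_intCast n k t, ← hk]
  simp [chr]

lemma hatCoeff_eq {h : ℝ} (hh : h ≠ 0) {n : ℤ} (hn : n ≠ 0) :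
    hatCoeff h n = (1 - Real.cos (2 * Real.pi * n * h)) / (2 * Real.pi ^ 2 * h * n ^ 2) := by
  have e : 2 * Real.pi * n * h = 2 * (Real.pi * n * h) := by ring
  rw [hatCoeff, Real.sinc_of_ne_zero (by positivity), e, Real.cos_two_mul', Real.cos_sq']
  field_simp
  ring

lemma hasSum_hat {h t x y z : ℝ} (hh : h ≠ 0) (hx : x ∈ Set.Icc (0 : ℝ) 1)
    (hy : y ∈ Set.Icc (0 : ℝ) 1) (hz : z ∈ Set.Icc (0 : ℝ) 1) (k l m : ℤ) (hk : x = t + k)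
    (hl : y = t + h + l) (hm : z = t - h + m) :
    HasSum (fun n : ℤ => chr n t • (hatCoeff h n : ℂ))
      ((h + ((x ^ 2 - x) - (y ^ 2 - y) / 2 - (z ^ 2 - z) / 2) / h : ℝ) : ℂ) := by
  have hp := Real.pi_ne_zero
  have h1 := ((((hasSum_chr_div_sq hx k hk).sub
    ((hasSum_chr_div_sq hy l hl).mul_left (1 / 2))).sub
    ((hasSum_chr_div_sq hz m hm).mul_left (1 / 2))).mul_left
      (1 / (2 * Real.pi ^ 2 * h : ℂ))).add (hasSum_ite_eq (0 : ℤ) (h : ℂ))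
  convert! h1 using 1
  · ext n
    by_cases hn : n = 0
    · simp [hn, hatCoeff, chr_zero]
    · have hn' : (n : ℂ) ≠ 0 := by exact_mod_cast hn
      have e2 : chr n (t - h) = chr n t * chr n (-h) := by rw [← chr_add_right, sub_eq_add_neg]
      have e3 : chr n h + chr n (-h) = 2 * (Real.cos (2 * Real.pi * n * h) : ℂ) := by
        rw [Complex.ofReal_cos, Complex.cos, chr, chr]
        push_cast
        rw [mul_div_cancel₀ _ two_ne_zero]
        congr 2 <;> ring
      have e4 : chr n (-h) = 2 * (Real.cos (2 * Real.pi * n * h) : ℂ) - chr n h := by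
        rw [← e3]; ring
      rw [if_neg hn, hatCoeff_eq hh hn, e2, chr_add_right, e4]
      push_cast
      rw [smul_eq_mul]
      field_simp
      ring
  · push_cast
    field_simp
    ring

lemma hat_add_intCast (h t : ℝ) (k : ℤ) : hat h (t + k) = hat h t := by
  simp only [hat, chr_add_intCast]

lemma hasSum_hat_of_abs_le {h t : ℝ} (hh : 0 < h) (hh' : h ≤ 1 / 2) (ht : |t| ≤ h) :
    HasSum (fun n : ℤ => chr n t • (hatCoeff h n : ℂ)) ((1 - |t| / h : ℝ) : ℂ) := by
  rw [abs_le] at ht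
  rcases le_total 0 t with h0 | h0
  · have := hasSum_hat (t := t) (x := t) (y := t + h) (z := t - h + 1) hh.ne'
      ⟨by linarith, by linarith⟩ ⟨by linarith, by linarith⟩
      ⟨by linarith, by linarith⟩ 0 0 1 (by simp) (by simp) (by simp)
    convert! this using 2
    rw [abs_of_nonneg h0]
    field_simp
    ring
  · have := hasSum_hat (t := t) (x := t + 1) (y := t + h) (z := t - h + 1) hh.ne'
      ⟨by linarith, by linarith⟩ ⟨by linarith, by linarith⟩
      ⟨by linarith, by linarith⟩ 1 0 1 (by simp) (by simp) (by simp)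
    convert! this using 2
    rw [abs_of_nonpos h0]
    field_simp
    ring

lemma hat_of_abs_le {h t : ℝ} (hh : 0 < h) (hh' : h ≤ 1 / 2) (ht : |t| ≤ h) :
    hat h t = 1 - |t| / h := by
  rw [hat, (hasSum_hat_of_abs_le hh hh' ht).tsum_eq]
  push_cast
  rfl

lemma hat_of_le_abs {h t : ℝ} (hh : 0 < h) (ht : h ≤ |t|) (ht' : |t| ≤ 1 / 2) :
    hat h t = 0 := by
  have key : ∀ t, t ∈ Set.Icc h (1 - h) → hat h t = 0 := fun t ht => by
    have := hasSum_hat (t := t) (x := t) (y := t + h) (z := t - h) hh.ne'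
      ⟨by linarith [ht.1], by linarith [ht.2]⟩ ⟨by linarith [ht.1], by linarith [ht.2]⟩
      ⟨by linarith [ht.1], by linarith [ht.2]⟩ 0 0 0 (by simp) (by simp) (by simp)
    rw [hat, this.tsum_eq, Complex.ofReal_eq_zero]
    field_simp
    ring
  rcases le_total 0 t with h0 | h0
  · rw [abs_of_nonneg h0] at ht ht'
    exact key t ⟨ht, by linarith⟩
  · rw [abs_of_nonpos h0] at ht ht'
    rw [← hat_add_intCast h t 1]
    exact key _ ⟨by push_cast; linarith, by push_cast; linarith⟩

lemma hasSum_hatCoeff {h : ℝ} (hh : 0 < h) (hh' : h ≤ 1 / 2) : HasSum (hatCoeff h) 1 := by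
  have := hasSum_hat_of_abs_le (t := 0) hh hh' (by simpa using hh.le)
  simp only [chr_at_zero, one_smul] at this
  have h2 := Complex.hasSum_ofReal.1 this
  simpa using h2

lemma summable_norm_hatCoeff {h : ℝ} (hh : 0 < h) (hh' : h ≤ 1 / 2) :
    Summable fun n => ‖(hatCoeff h n : ℂ)‖ := by
  refine (hasSum_hatCoeff hh hh').summable.congr fun n => ?_
  rw [Complex.norm_real, Real.norm_of_nonneg (hatCoeff_nonneg hh.le n)]

lemma wienerBound_hat {h : ℝ} (hh : 0 < h) (hh' : h ≤ 1 / 2) : WienerBound (hat h) 1 := by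
  refine (wienerBound_tsum (fun n : ℤ => n) (summable_norm_hatCoeff hh hh')).mono (le_of_eq ?_)
  rw [← (hasSum_hatCoeff hh hh').tsum_eq]
  refine tsum_congr fun n => ?_
  rw [Complex.norm_real, Real.norm_of_nonneg (hatCoeff_nonneg hh.le n)]

lemma hatCoeff_le {h : ℝ} (hh : 0 < h) (hh' : h ≤ 1) (n : ℤ) :
    hatCoeff h n ≤ 4 / (h * (1 + |(n : ℝ)|) ^ 2) := by
  by_cases hn : n = 0
  · simp only [hn, hatCoeff, Int.cast_zero, mul_zero, zero_mul, Real.sinc_zero, one_pow, mul_one,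
      abs_zero, add_zero]
    rw [le_div_iff₀ hh]
    nlinarith
  · have hn1 : (1 : ℝ) ≤ |(n : ℝ)| := by exact_mod_cast Int.one_le_abs hn
    have hn2 : (n : ℝ) ^ 2 = |(n : ℝ)| ^ 2 := (sq_abs _).symm
    have hc := Real.neg_one_le_cos (2 * Real.pi * n * h)
    have hp := Real.pi_gt_three
    rw [hatCoeff_eq hh.ne' hn, hn2]
    set m := |(n : ℝ)|
    calc _ ≤ 2 / (2 * Real.pi ^ 2 * h * m ^ 2) := by gcongr; linarith
      _ ≤ 4 / (h * (1 + m) ^ 2) := by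
        rw [div_le_div_iff₀ (by positivity) (by positivity)]
        have h1 : (1 + m) ^ 2 ≤ 4 * m ^ 2 := by nlinarith
        have h2 : (9 : ℝ) ≤ Real.pi ^ 2 := by nlinarith
        have h3 : 0 ≤ h * m ^ 2 := by positivity
        nlinarith [mul_le_mul_of_nonneg_left h1 hh.le, mul_le_mul_of_nonneg_right h2 h3]

lemma abs_hatCoeff_sub_le {h : ℝ} (hh : 0 < h) (n : ℤ) :
    |hatCoeff h (n - 1) - hatCoeff h n| ≤ 2 * Real.pi * h ^ 2 := by
  unfold hatCoeff
  set x := Real.sinc (Real.pi * (n - 1 : ℤ) * h)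
  set y := Real.sinc (Real.pi * n * h)
  have hx : |x| ≤ 1 := Real.abs_sinc_le_one _
  have hy : |y| ≤ 1 := Real.abs_sinc_le_one _
  have h1 : |x - y| ≤ Real.pi * h := by
    refine (abs_sinc_sub_le _ _).trans (le_of_eq ?_)
    have : Real.pi * (n - 1 : ℤ) * h - Real.pi * n * h = -(Real.pi * h) := by push_cast; ring
    rw [this, abs_neg, abs_of_pos (by positivity)]
  have h2 : |x + y| ≤ 2 :=
    (abs_add_le _ _).trans (by linarith)
  have e : h * x ^ 2 - h * y ^ 2 = h * ((x - y) * (x + y)) := by ring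
  rw [e, abs_mul, abs_mul, abs_of_pos hh]
  calc _ ≤ h * (Real.pi * h * 2) := by gcongr
    _ = _ := by ring

lemma abs_hatCoeff_sub_le_rpow {h : ℝ} (hh : 0 < h) (hh' : h ≤ 1) (n : ℤ) :
    |hatCoeff h (n - 1) - hatCoeff h n| ≤
      20 * h ^ (1 / 5 : ℝ) * (1 + |(n : ℝ)|) ^ (-(6 / 5) : ℝ) := by
  set d := |hatCoeff h (n - 1) - hatCoeff h n|
  set m := 1 + |(n : ℝ)|
  have hm : 0 < m := by positivity
  have hd : 0 ≤ d := abs_nonneg _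
  have h1 : d ≤ 20 * h ^ 2 := (abs_hatCoeff_sub_le hh n).trans (by
    nlinarith [Real.pi_lt_four, sq_nonneg h, Real.pi_pos])
  have h2 : d ≤ 20 * (h * m ^ 2)⁻¹ := by
    have ha := hatCoeff_le hh hh' n
    have hb := hatCoeff_le hh hh' (n - 1)
    have hm2 : m ≤ 2 * (1 + |((n - 1 : ℤ) : ℝ)|) := by
      have := abs_sub_abs_le_abs_sub (n : ℝ) 1
      push_cast
      rw [abs_one] at this
      have h0 := abs_nonneg ((n : ℝ) - 1)
      simp only [m]
      linarith
    have hb' : hatCoeff h (n - 1) ≤ 16 / (h * m ^ 2) := by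
      refine hb.trans ?_
      rw [div_le_div_iff₀ (by positivity) (by positivity)]
      have : m ^ 2 ≤ (2 * (1 + |((n - 1 : ℤ) : ℝ)|)) ^ 2 := by gcongr
      nlinarith [mul_le_mul_of_nonneg_left this hh.le]
    have := hatCoeff_nonneg hh.le n
    have := hatCoeff_nonneg hh.le (n - 1)
    have h4 : (4 : ℝ) / (h * m ^ 2) ≤ 20 / (h * m ^ 2) := by gcongr; norm_num
    have h16 : (16 : ℝ) / (h * m ^ 2) ≤ 20 / (h * m ^ 2) := by gcongr; norm_num
    rw [← div_eq_mul_inv]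
    exact abs_le.2 ⟨by linarith, by linarith⟩
  have h3 : d = d ^ (2 / 5 : ℝ) * d ^ (3 / 5 : ℝ) := by
    rw [← Real.rpow_add_of_nonneg hd (by norm_num) (by norm_num)]
    norm_num
  have e1 : (20 * h ^ 2) ^ (2 / 5 : ℝ) = 20 ^ (2 / 5 : ℝ) * h ^ (4 / 5 : ℝ) := by
    rw [Real.mul_rpow (by norm_num) (by positivity), ← Real.rpow_natCast, ← Real.rpow_mul hh.le]
    norm_num
  have e2 : (20 * (h * m ^ 2)⁻¹) ^ (3 / 5 : ℝ) =
      20 ^ (3 / 5 : ℝ) * (h ^ (-(3 / 5) : ℝ) * m ^ (-(6 / 5) : ℝ)) := by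
    rw [Real.mul_rpow (by norm_num) (by positivity), Real.inv_rpow (by positivity),
      Real.mul_rpow hh.le (by positivity), ← Real.rpow_natCast m, ← Real.rpow_mul hm.le,
      mul_inv, ← Real.rpow_neg hh.le, ← Real.rpow_neg hm.le]
    norm_num
  have e3 : (20 : ℝ) ^ (2 / 5 : ℝ) * 20 ^ (3 / 5 : ℝ) = 20 := by
    rw [← Real.rpow_add (by norm_num)]
    norm_num
  have e4 : h ^ (4 / 5 : ℝ) * h ^ (-(3 / 5) : ℝ) = h ^ (1 / 5 : ℝ) := by
    rw [← Real.rpow_add hh]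
    norm_num
  calc d = d ^ (2 / 5 : ℝ) * d ^ (3 / 5 : ℝ) := h3
    _ ≤ (20 * h ^ 2) ^ (2 / 5 : ℝ) * (20 * (h * m ^ 2)⁻¹) ^ (3 / 5 : ℝ) := by gcongr
    _ = (20 ^ (2 / 5 : ℝ) * 20 ^ (3 / 5 : ℝ)) * (h ^ (4 / 5 : ℝ) * h ^ (-(3 / 5) : ℝ)) *
        m ^ (-(6 / 5) : ℝ) := by rw [e1, e2]; ring
    _ = _ := by rw [e3, e4]

lemma summable_one_add_abs_rpow :
    Summable fun n : ℤ => (1 + |(n : ℝ)|) ^ (-(6 / 5) : ℝ) := by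
  have h : Summable fun n : ℕ => (1 + (n : ℝ)) ^ (-(6 / 5) : ℝ) := by
    have := (summable_nat_add_iff 1).2
      (Real.summable_nat_rpow.2 (by norm_num : (-(6 / 5) : ℝ) < -1))
    refine this.congr fun n => ?_
    push_cast
    rw [add_comm]
  refine Summable.of_nat_of_neg ?_ ?_
  · simpa using h
  · simpa using h

lemma wienerBound_hat_mul_chr_sub_one :
    ∃ C : ℝ, ∀ h : ℝ, 0 < h → h ≤ 1 / 2 →
      WienerBound (fun t => hat h t * (chr 1 t - 1)) (C * h ^ (1 / 5 : ℝ)) := by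
  refine ⟨∑' n : ℤ, 20 * (1 + |(n : ℝ)|) ^ (-(6 / 5) : ℝ), fun h hh hh' => ?_⟩
  have hb := fun n => abs_hatCoeff_sub_le_rpow hh (by linarith) n
  have hs : Summable fun n : ℤ => 20 * h ^ (1 / 5 : ℝ) * (1 + |(n : ℝ)|) ^ (-(6 / 5) : ℝ) :=
    summable_one_add_abs_rpow.mul_left _
  have hn : ∀ n : ℤ, ‖((hatCoeff h (n - 1) : ℂ) - hatCoeff h n)‖ =
      |hatCoeff h (n - 1) - hatCoeff h n| := fun n => by
    rw [← Complex.ofReal_sub, Complex.norm_real, Real.norm_eq_abs]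
  have hs' : Summable fun n : ℤ => ‖((hatCoeff h (n - 1) : ℂ) - hatCoeff h n)‖ := by
    simp only [hn]
    exact hs.of_nonneg_of_le (fun _ => abs_nonneg _) hb
  refine ⟨ℤ, id, fun n => (hatCoeff h (n - 1) : ℂ) - hatCoeff h n, hs', ?_, fun t => ?_⟩
  · simp only [hn] at hs' ⊢
    refine (hs'.tsum_le_tsum hb hs).trans (le_of_eq ?_)
    rw [← tsum_mul_right]
    exact tsum_congr fun n => by ring
  · have h1 := hasSum_chr_smul (fun n : ℤ => n) (summable_norm_hatCoeff hh hh') t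
    have h2 := ((Equiv.subRight (1 : ℤ)).hasSum_iff.2 h1).mul_left (chr 1 t)
    have h3 := h2.sub h1
    have e : hat h t * (chr 1 t - 1) = chr 1 t * hat h t - hat h t := by ring
    change HasSum _ (hat h t * (chr 1 t - 1))
    rw [e]
    refine h3.congr_fun fun n => ?_
    simp only [Function.comp_apply, Equiv.subRight_apply, smul_eq_mul, id]
    rw [← mul_assoc, ← chr_add, add_sub_cancel]
    ring

/-- The `1`-periodic trapezoid function, equal to `1` on `[-h, h]` and vanishing away from
`[-2h, 2h]`. -/
def trapezoid (h t : ℝ) : ℂ := 2 * hat (2 * h) t - hat h t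

lemma trapezoid_of_abs_le {h t : ℝ} (hh : 0 < h) (hh' : h ≤ 1 / 4) (ht : |t| ≤ h) :
    trapezoid h t = 1 := by
  rw [trapezoid, hat_of_abs_le hh (by linarith) ht,
    hat_of_abs_le (by linarith) (by linarith) (by linarith)]
  have : (h : ℂ) ≠ 0 := by exact_mod_cast hh.ne'
  push_cast
  field_simp
  ring

lemma trapezoid_of_le_abs {h t : ℝ} (hh : 0 < h) (ht : 2 * h ≤ |t|) (ht' : |t| ≤ 1 / 2) :
    trapezoid h t = 0 := by
  rw [trapezoid, hat_of_le_abs hh (by linarith) ht', hat_of_le_abs (by linarith) ht ht']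
  ring

lemma trapezoid_eq_one_of_ne_zero {h t : ℝ} (hh : 0 < h) (hh' : h ≤ 1 / 8)
    (ht : trapezoid h t ≠ 0) : trapezoid (2 * h) t = 1 := by
  have e : ∀ h, trapezoid h t = trapezoid h (t - round t) := fun h => by
    have := fun h => hat_add_intCast h t (-round t)
    simp only [Int.cast_neg, ← sub_eq_add_neg] at this
    simp only [trapezoid, this]
  rw [e] at ht ⊢
  refine trapezoid_of_abs_le (by linarith) (by linarith) ?_
  by_contra! hlt
  exact ht (trapezoid_of_le_abs hh hlt.le (abs_sub_round t))

/-- A sequence of cutoff functions concentrating at the integers. -/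
lemma exists_cutoff : ∃ (φ : ℕ → ℝ → ℂ) (η : ℕ → ℝ),
    (∀ k, WienerBound (φ k) 3) ∧
    (∀ k, WienerBound (fun t => φ k t * (chr 1 t - 1)) (η k)) ∧
    Tendsto η atTop (nhds 0) ∧
    (∀ k, ∀ᶠ t in nhds (0 : ℝ), φ k t = 1) ∧
    ∀ k t, φ (k + 1) t ≠ 0 → φ k t = 1 := by
  obtain ⟨C, hC⟩ := wienerBound_hat_mul_chr_sub_one
  let h : ℕ → ℝ := fun k => (1 / 2) ^ (k + 3)
  have hpos : ∀ k, 0 < h k := fun k => by positivity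
  have hle : ∀ k, h k ≤ 1 / 8 := fun k => by
    have : ((1 : ℝ) / 2) ^ (k + 3) ≤ (1 / 2) ^ 3 :=
      pow_le_pow_of_le_one (by norm_num) (by norm_num) (by omega)
    exact this.trans (by norm_num)
  have htend : Tendsto h atTop (nhds 0) :=
    (tendsto_add_atTop_iff_nat 3).2
      (tendsto_pow_atTop_nhds_zero_of_lt_one (by norm_num) (by norm_num))
  refine ⟨fun k => trapezoid (h k),
    fun k => 2 * (C * (2 * h k) ^ (1 / 5 : ℝ)) + C * h k ^ (1 / 5 : ℝ), fun k => ?_, fun k => ?_,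
    ?_, fun k => ?_, fun k t hk => ?_⟩
  · have h1 := wienerBound_hat (h := 2 * h k) (by linarith [hpos k]) (by linarith [hle k])
    have h2 := wienerBound_hat (h := h k) (hpos k) (by linarith [hle k])
    refine ((h1.const_smul 2).sub h2).mono ?_
    norm_num
  · have h1 := hC (2 * h k) (by linarith [hpos k]) (by linarith [hle k])
    have h2 := hC (h k) (hpos k) (by linarith [hle k])
    have h3 := (h1.const_smul 2).sub h2
    refine (h3.congr fun t => ?_).mono (by norm_num)
    simp only [trapezoid, smul_eq_mul]
    ring
  · have h1 : Tendsto (fun k => h k ^ (1 / 5 : ℝ)) atTop (nhds 0) := by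
      have := htend.rpow_const (p := 1 / 5) (Or.inr (by norm_num))
      simpa using this
    have h2 : Tendsto (fun k => (2 * h k) ^ (1 / 5 : ℝ)) atTop (nhds 0) := by
      have := (htend.const_mul 2).rpow_const (p := 1 / 5) (Or.inr (by norm_num))
      simpa using this
    simpa using ((h2.const_mul C).const_mul 2).add (h1.const_mul C)
  · filter_upwards [Metric.closedBall_mem_nhds (0 : ℝ) (hpos k)] with t ht
    rw [Metric.mem_closedBall, Real.dist_eq, sub_zero] at ht
    exact trapezoid_of_abs_le (hpos k) (by linarith [hle k]) ht
  · have e : h k = 2 * h (k + 1) := by simp only [h]; ring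
    simp only [e]
    exact trapezoid_eq_one_of_ne_zero (hpos _) (hle _) hk

end Cutoff

section Spectral

variable {A : Type*} [NormedRing A] [NormedAlgebra ℂ A] [CompleteSpace A]

lemma exists_norm_pow_le_of_spectralRadius_lt_one {a : A} (ha : spectralRadius ℂ a < 1) :
    ∃ C q : ℝ, 0 ≤ C ∧ 0 < q ∧ q < 1 ∧ ∀ k, ‖a ^ k‖ ≤ C * q ^ k := by
  obtain ⟨p, hp1, hp2⟩ := exists_between ha
  lift p to NNReal using hp2.ne_top
  have hp0 : 0 < p := by
    have := zero_le.trans_lt hp1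
    exact_mod_cast this
  have hev : ∀ᶠ n : ℕ in atTop, ‖a ^ n‖ ≤ (p : ℝ) ^ n := by
    filter_upwards [(spectrum.pow_nnnorm_pow_one_div_tendsto_nhds_spectralRadius a).eventually
      (gt_mem_nhds hp1), eventually_ge_atTop 1] with n hn h1
    have hn0 : (n : ℝ) ≠ 0 := by positivity
    have h2 := ENNReal.rpow_le_rpow hn.le (Nat.cast_nonneg (α := ℝ) n)
    rw [← ENNReal.rpow_mul, one_div, inv_mul_cancel₀ hn0, ENNReal.rpow_one,
      ENNReal.rpow_natCast] at h2
    exact_mod_cast h2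
  obtain ⟨N, hN⟩ := eventually_atTop.1 hev
  have hp0' : (0 : ℝ) < p := hp0
  have hs : 0 ≤ ∑ n ∈ Finset.range N, ‖a ^ n‖ / (p : ℝ) ^ n :=
    Finset.sum_nonneg fun n _ => by positivity
  refine ⟨1 + ∑ n ∈ Finset.range N, ‖a ^ n‖ / (p : ℝ) ^ n, p, by linarith, hp0',
    by exact_mod_cast hp2, fun k => ?_⟩
  rcases le_or_gt N k with h | h
  · have := hN k h
    have h2 : 0 ≤ (p : ℝ) ^ k := by positivity
    nlinarith
  · have h1 := Finset.single_le_sum (f := fun n => ‖a ^ n‖ / (p : ℝ) ^ n)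
      (fun n _ => by positivity) (Finset.mem_range.2 h)
    rw [← div_le_iff₀ (by positivity)]
    linarith

lemma WienerBound.const_add_pow {a : A} {H : ℝ → A} {C q ε : ℝ}
    (ha : ∀ k, ‖a ^ k‖ ≤ C * q ^ k) (hH : WienerBound H ε) (k : ℕ) :
    WienerBound (fun t => (a + H t) ^ k) (C * (q + C * ε) ^ k) := by
  suffices h : ∀ k j, WienerBound (fun t => a ^ j * (a + H t) ^ k) (C * q ^ j * (q + C * ε) ^ k) by
    simpa using h k 0
  intro k
  induction k with
  | zero =>
    intro j
    simpa using (wienerBound_const (a ^ j)).mono (ha j)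
  | succ k ih =>
    intro j
    have h1 := ih (j + 1)
    have h2 := ((wienerBound_const (a ^ j)).mono (ha j)).mul (hH.mul (ih 0))
    refine ((h1.add h2).congr fun t => ?_).mono (le_of_eq (by ring))
    rw [pow_succ' (a + H t), add_mul, mul_add, pow_succ, mul_assoc, pow_zero, one_mul]

end Spectral

section Localization

variable {E : Type*} [NormedAddCommGroup E] [NormedSpace ℂ E] [CompleteSpace E]

/-- The Fourier series `t ↦ ∑ exp (2πint) fₙ` of a sequence. -/
def fourierSum (f : ℕ → E) (t : ℝ) : E := ∑' n : ℕ, chr n t • f n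

lemma hasSum_fourierSum {f : ℕ → E} (hf : Summable fun n => ‖f n‖) (t : ℝ) :
    HasSum (fun n : ℕ => chr n t • f n) (fourierSum f t) :=
  hasSum_chr_smul (fun n : ℕ => (n : ℤ)) hf t

lemma wienerBound_fourierSum {f : ℕ → E} (hf : Summable fun n => ‖f n‖) :
    WienerBound (fourierSum f) (∑' n, ‖f n‖) :=
  wienerBound_tsum (fun n : ℕ => (n : ℤ)) hf

lemma fourierSum_eq_sum_add {f : ℕ → E} (hf : Summable fun n => ‖f n‖) (m : ℕ) (t : ℝ) :
    fourierSum f t = ∑ n ∈ Finset.range m, chr n t • f n +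
      ∑' n : ℕ, chr ((n + m : ℕ) : ℤ) t • f (n + m) :=
  ((hasSum_fourierSum hf t).summable.sum_add_tsum_nat_add m).symm

lemma chr_natCast_sub_one (n : ℕ) (t : ℝ) :
    chr n t - 1 = (chr 1 t - 1) * ∑ i ∈ Finset.range n, chr i t := by
  simp only [chr_natCast]
  rw [mul_geom_sum]

lemma WienerBound.mul_chr_natCast_sub_one {φ : ℝ → ℂ} {K : ℝ}
    (h : WienerBound (fun t => φ t * (chr 1 t - 1)) K) (n : ℕ) :
    WienerBound (fun t => φ t * (chr n t - 1)) (K * n) := by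
  have h1 := WienerBound.sum (Finset.range n) fun i _ => wienerBound_chr (i : ℤ)
  refine ((h.mul h1).congr fun t => ?_).mono (by simp)
  rw [chr_natCast_sub_one, mul_assoc]

/-- Splitting a Fourier series minus its value at `0` into a head and a tail. -/
lemma WienerBound.smul_fourierSum_sub {f : ℕ → E} (hf : Summable fun n => ‖f n‖) {φ : ℝ → ℂ}
    {K K' : ℝ} (hφ : WienerBound φ K) (hφ' : WienerBound (fun t => φ t * (chr 1 t - 1)) K')
    (m : ℕ) :
    WienerBound (fun t => φ t • (fourierSum f t - fourierSum f 0))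
      (K' * ∑ n ∈ Finset.range m, n * ‖f n‖ + K * (2 * ∑' n, ‖f (n + m)‖)) := by
  have hfm : Summable fun n => ‖f (n + m)‖ := (summable_nat_add_iff m).2 hf
  have h1 := WienerBound.sum (Finset.range m)
    fun n _ => (hφ'.mul_chr_natCast_sub_one n).smul (wienerBound_const (f n))
  have h2 := wienerBound_tsum (fun n : ℕ => ((n + m : ℕ) : ℤ)) hfm
  have h3 := (wienerBound_const (∑' n, f (n + m))).mono (norm_tsum_le_tsum_norm hfm)
  have h4 := h1.add (hφ.smul (h2.sub h3))
  refine (h4.congr fun t => ?_).mono ?_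
  · rw [fourierSum_eq_sum_add hf m t, fourierSum_eq_sum_add hf m 0]
    simp only [chr_at_zero, one_smul, mul_sub, mul_one, sub_smul, Finset.sum_sub_distrib,
      smul_sub, smul_add, Finset.smul_sum, smul_smul]
    abel
  · simp only [Finset.mul_sum, two_mul, mul_assoc, le_refl]

lemma exists_localization {φ : ℕ → ℝ → ℂ} {η : ℕ → ℝ} {K : ℝ}
    (hφ : ∀ k, WienerBound (φ k) K)
    (hφ' : ∀ k, WienerBound (fun t => φ k t * (chr 1 t - 1)) (η k))
    (hη : Tendsto η atTop (nhds 0)) {f : ℕ → E} (hf : Summable fun n => ‖f n‖) (t₀ : ℝ)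
    {ε : ℝ} (hε : 0 < ε) :
    ∃ k, WienerBound (fun t => φ k (t - t₀) • (fourierSum f t - fourierSum f t₀)) ε := by
  let g : ℕ → E := fun n => chr n t₀ • f n
  have hg : Summable fun n => ‖g n‖ := by
    simpa only [g, norm_smul, norm_chr, one_mul] using hf
  have hgf : ∀ s, fourierSum g s = fourierSum f (s + t₀) := fun s => by
    simp only [fourierSum, g, smul_smul, chr_add_right]
  obtain ⟨m, hm⟩ : ∃ m, K * (2 * ∑' n, ‖g (n + m)‖) < ε / 2 := by
    have := ((tendsto_sum_nat_add fun n => ‖g n‖).const_mul 2).const_mul K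
    rw [mul_zero, mul_zero] at this
    exact (this.eventually (gt_mem_nhds (half_pos hε))).exists
  obtain ⟨k, hk⟩ : ∃ k, η k * ∑ n ∈ Finset.range m, n * ‖g n‖ < ε / 2 := by
    have := hη.mul_const (∑ n ∈ Finset.range m, n * ‖g n‖)
    rw [zero_mul] at this
    exact (this.eventually (gt_mem_nhds (half_pos hε))).exists
  refine ⟨k, ?_⟩
  have h := ((WienerBound.smul_fourierSum_sub hg (hφ k) (hφ' k) m).translate (-t₀)).mono
    (K' := ε) (by linarith)
  refine h.congr fun t => ?_
  simp only [hgf]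
  rw [← sub_eq_add_neg, sub_add_cancel, zero_add]

end Localization

section Tail

/-- The tail `∑_{j > n} r j` of a series. -/
def tailSum (r : ℕ → ℝ) (n : ℕ) : ℝ := ∑' j, r (j + (n + 1))

variable {r τ : ℕ → ℝ}

lemma tsum_ite_lt_eq_tailSum (hr : Summable r) (n : ℕ) :
    (∑' j : ℕ, if n < j then r j else 0) = tailSum r n := by
  have hs : Summable fun j => if n < j then r j else 0 :=
    (hr.indicator {j | n < j}).congr fun j => by simp [Set.indicator_apply]
  rw [← hs.sum_add_tsum_nat_add (n + 1), Finset.sum_eq_zero, zero_add, tailSum]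
  · exact tsum_congr fun j => if_pos (by omega)
  · intro j hj
    rw [Finset.mem_range] at hj
    exact if_neg (by omega)

lemma tailSum_eq_add (hr : Summable r) (n : ℕ) : tailSum r n = r (n + 1) + tailSum r (n + 1) := by
  have hs : Summable fun j => r (j + (n + 1)) := (summable_nat_add_iff (n + 1)).2 hr
  rw [tailSum, hs.tsum_eq_zero_add, zero_add, tailSum]
  congr 1
  exact tsum_congr fun j => by congr 1; ring

lemma tailSum_eq_sum_add (hr : Summable r) {m n : ℕ} (h : m ≤ n) :
    tailSum r m = ∑ j ∈ Finset.Ioc m n, r j + tailSum r n := by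
  induction n, h using Nat.le_induction with
  | base => simp
  | succ n h ih =>
    have e : Finset.Ioc m (n + 1) = insert (n + 1) (Finset.Ioc m n) := by
      ext j
      simp only [Finset.mem_Ioc, Finset.mem_insert]
      omega
    rw [e, Finset.sum_insert (by simp), ih, tailSum_eq_add hr n]
    ring

lemma antitone_tailSum (hr : Summable r) (h0 : ∀ n, 0 ≤ r n) : Antitone (tailSum r) :=
  antitone_nat_of_succ_le fun n => by
    rw [tailSum_eq_add hr n]
    linarith [h0 (n + 1)]

lemma exists_sum_le_mul_of_doubling (hτ : Antitone τ) (hpos : ∀ n, 0 < τ n) {s : ℝ} (hs : s < 1)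
    (h : ∀ᶠ m in atTop, τ m ≤ 2 ^ s * τ (2 * m)) :
    ∃ C : ℝ, 0 < C ∧ ∀ n, ∑ j ∈ Finset.Icc 1 n, τ j ≤ C * n * τ n := by
  have hD : (2 : ℝ) ^ s < 2 := by
    simpa using Real.rpow_lt_rpow_of_exponent_lt (x := 2) (by norm_num) hs
  set D : ℝ := 2 ^ s
  obtain ⟨n₀, hn₀⟩ := eventually_atTop.1 h
  obtain ⟨n₁, hn₁⟩ := exists_nat_gt (D / (1 - D / 2))
  have hD1 : 0 < 1 - D / 2 := by linarith
  rw [div_lt_iff₀ hD1] at hn₁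
  let N := 2 * (n₀ + n₁ + 1)
  let C := max (τ 0 / τ N) (D / (1 - D / 2))
  have hC1 : τ 0 ≤ C * τ N := by
    rw [← div_le_iff₀ (hpos N)]
    exact le_max_left _ _
  have hC2 : D ≤ C * (1 - D / 2) := by
    rw [← div_le_iff₀ hD1]
    exact le_max_right _ _
  have hC : 0 < C := lt_max_of_lt_left (div_pos (hpos _) (hpos _))
  refine ⟨C, hC, fun n => ?_⟩
  induction n using Nat.strong_induction_on with
  | _ n ih =>
    rcases le_or_gt n N with hn | hn
    · calc ∑ j ∈ Finset.Icc 1 n, τ j ≤ ∑ j ∈ Finset.Icc 1 n, τ 0 :=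
          Finset.sum_le_sum fun j _ => hτ (Nat.zero_le j)
        _ = n * τ 0 := by simp
        _ ≤ n * (C * τ n) := by
          gcongr
          exact hC1.trans (by gcongr; exact hτ hn)
        _ = C * n * τ n := by ring
    · have hN : N = 2 * (n₀ + n₁ + 1) := rfl
      obtain ⟨m, hm1, hm2⟩ : ∃ m, n ≤ 2 * m ∧ 2 * m ≤ n + 1 := ⟨(n + 1) / 2, by omega, by omega⟩
      have hmn : m < n := by omega
      have h1 := ih m hmn
      have h2 : τ m ≤ D * τ n :=
        (hn₀ m (by omega)).trans (by gcongr; exact hτ hm1)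
      have h3 : ∑ j ∈ Finset.Ioc m n, τ j ≤ (n - m) * τ m := by
        calc _ ≤ ∑ j ∈ Finset.Ioc m n, τ m :=
              Finset.sum_le_sum fun j hj => hτ (Finset.mem_Ioc.1 hj).1.le
          _ = _ := by simp [Nat.cast_sub hmn.le]
      have e : ∑ j ∈ Finset.Icc 1 n, τ j =
          ∑ j ∈ Finset.Icc 1 m, τ j + ∑ j ∈ Finset.Ioc m n, τ j := by
        have e1 : ∀ k, Finset.Icc 1 k = Finset.Ioc 0 k := fun k => by
          ext j
          simp only [Finset.mem_Icc, Finset.mem_Ioc]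
          omega
        rw [e1, e1, Finset.sum_Ioc_consecutive _ (Nat.zero_le m) hmn.le]
      have hm2' : 2 * (m : ℝ) ≤ n + 1 := by exact_mod_cast hm2
      have hmn' : (m : ℝ) ≤ n := by exact_mod_cast hmn.le
      have hm1' : (n : ℝ) ≤ 2 * m := by exact_mod_cast hm1
      have hn1 : (n₁ : ℝ) ≤ n / 2 := by
        have : 2 * n₁ ≤ n := by omega
        have : 2 * (n₁ : ℝ) ≤ n := by exact_mod_cast this
        linarith
      rw [e]
      calc _ ≤ (C * m + (n - m)) * τ m := by linarith
        _ ≤ (C * m + (n - m)) * (D * τ n) := by gcongr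
        _ = (D * (C * m + (n - m))) * τ n := by ring
        _ ≤ _ := by
          refine mul_le_mul_of_nonneg_right ?_ (hpos n).le
          · have h5 : D ≤ n / 2 * (1 - D / 2) := hn₁.le.trans (by gcongr)
            have h6 : D * (C * m) ≤ D * C * ((n + 1) / 2) := by
              rw [← mul_assoc]
              gcongr
              linarith
            have h8 := mul_le_mul_of_nonneg_left h5 hC.le
            have h9 := mul_le_mul_of_nonneg_left hC2 (Nat.cast_nonneg (α := ℝ) n)
            nlinarith

lemma exists_rpow_le_of_doubling (hτ : Antitone τ) (hpos : ∀ n, 0 < τ n) {s : ℝ} (hs : 0 ≤ s)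
    (h : ∀ᶠ m in atTop, τ m ≤ 2 ^ s * τ (2 * m)) :
    ∃ c : ℝ, 0 < c ∧ ∀ n : ℕ, 1 ≤ n → c * (n : ℝ) ^ (-s) ≤ τ n := by
  obtain ⟨n₀, hn₀⟩ := eventually_atTop.1 h
  have key : ∀ n : ℕ, τ (2 * n₀ + 2) * ((n + 1 : ℕ) : ℝ) ^ (-s) ≤ τ (n + 2) := by
    intro n
    induction n using Nat.strong_induction_on with
    | _ n ih =>
      rcases le_or_gt n (2 * n₀) with hn | hn
      · calc _ ≤ τ (2 * n₀ + 2) * 1 := by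
              gcongr
              · exact (hpos _).le
              · exact Real.rpow_le_one_of_one_le_of_nonpos
                  (by push_cast; linarith [Nat.cast_nonneg (α := ℝ) n]) (by linarith)
          _ ≤ _ := by
            rw [mul_one]
            exact hτ (by omega)
      · obtain ⟨m, hm1, hm2⟩ : ∃ m, 2 * m + 2 ≤ n + 1 ∧ n ≤ 2 * m + 2 :=
          ⟨(n - 1) / 2, by omega, by omega⟩
        have h1 := ih m (by omega)
        have h2 := hn₀ (m + 2) (by omega)
        have h3 : τ (2 * (m + 2)) ≤ τ (n + 2) := hτ (by omega)
        have h4 : ((n + 1 : ℕ) : ℝ) ^ (-s) ≤ (2 * ((m + 1 : ℕ) : ℝ)) ^ (-s) := by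
          refine Real.rpow_le_rpow_of_nonpos (by positivity) ?_ (by linarith)
          exact_mod_cast (by omega : 2 * (m + 1) ≤ n + 1)
        rw [Real.mul_rpow zero_le_two (Nat.cast_nonneg _), Real.rpow_neg zero_le_two] at h4
        have h5 : (0 : ℝ) < 2 ^ s := by positivity
        calc _ ≤ τ (2 * n₀ + 2) * (((2 : ℝ) ^ s)⁻¹ * ((m + 1 : ℕ) : ℝ) ^ (-s)) := by
              gcongr
              exact (hpos _).le
          _ = ((2 : ℝ) ^ s)⁻¹ * (τ (2 * n₀ + 2) * ((m + 1 : ℕ) : ℝ) ^ (-s)) := by ring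
          _ ≤ ((2 : ℝ) ^ s)⁻¹ * (2 ^ s * τ (2 * (m + 2))) :=
            mul_le_mul_of_nonneg_left (h1.trans h2) (inv_nonneg.2 h5.le)
          _ = τ (2 * (m + 2)) := by field_simp
          _ ≤ _ := h3
  refine ⟨τ (2 * n₀ + 2), hpos _, fun n hn => ?_⟩
  obtain ⟨m, rfl⟩ : ∃ m, n = m + 1 := ⟨n - 1, by omega⟩
  exact (key m).trans (hτ (by omega))

lemma exists_le_rpow_of_doubling (hτ : Antitone τ) (hpos : ∀ n, 0 < τ n) {s : ℝ} (hs : 0 ≤ s)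
    (h : ∀ᶠ m in atTop, τ (2 * m) ≤ 2 ^ (-s) * τ m) :
    ∃ C : ℝ, 0 < C ∧ ∀ n : ℕ, τ n ≤ C * ((n : ℝ) + 1) ^ (-s) := by
  obtain ⟨n₀, hn₀⟩ := eventually_atTop.1 h
  have hC : 0 < τ 0 * (2 * n₀ + 1 : ℝ) ^ s := mul_pos (hpos 0) (by positivity)
  refine ⟨τ 0 * (2 * n₀ + 1 : ℝ) ^ s, hC, fun n => ?_⟩
  induction n using Nat.strong_induction_on with
  | _ n ih =>
    rcases le_or_gt n (2 * n₀) with hn | hn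
    · have hn' : (n : ℝ) ≤ 2 * n₀ := by exact_mod_cast hn
      rw [mul_assoc, Real.rpow_neg (by positivity), ← div_eq_mul_inv]
      have h1 : 1 ≤ (2 * n₀ + 1 : ℝ) ^ s / ((n : ℝ) + 1) ^ s := by
        rw [one_le_div (by positivity)]
        gcongr
      have h2 : τ n ≤ τ 0 := hτ (Nat.zero_le n)
      nlinarith [hpos 0]
    · obtain ⟨m, hm1, hm2⟩ : ∃ m, 2 * m ≤ n ∧ n ≤ 2 * m + 1 := ⟨n / 2, by omega, by omega⟩
      have h1 := ih m (by omega)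
      have h2 := hn₀ m (by omega)
      have h3 : τ n ≤ τ (2 * m) := hτ hm1
      have h4 : (2 * ((m : ℝ) + 1)) ^ (-s) ≤ ((n : ℝ) + 1) ^ (-s) := by
        refine Real.rpow_le_rpow_of_nonpos (by positivity) ?_ (by linarith)
        have : (n : ℝ) ≤ 2 * m + 1 := by exact_mod_cast hm2
        linarith
      rw [Real.mul_rpow (by norm_num) (by positivity)] at h4
      calc τ n ≤ 2 ^ (-s) * τ m := h3.trans h2
        _ ≤ 2 ^ (-s) * (τ 0 * (2 * n₀ + 1 : ℝ) ^ s * ((m : ℝ) + 1) ^ (-s)) := by gcongr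
        _ = τ 0 * (2 * n₀ + 1 : ℝ) ^ s * (2 ^ (-s) * ((m : ℝ) + 1) ^ (-s)) := by ring
        _ ≤ _ := by gcongr

lemma eventually_le_two_rpow_mul (hpos : ∀ n, 0 < τ n) {β s : ℝ} (hs : β < s)
    (h : Tendsto (fun n => τ (2 * n) / τ n) atTop (nhds (2 ^ (-β)))) :
    ∀ᶠ m in atTop, τ m ≤ 2 ^ s * τ (2 * m) := by
  have hlt : (2 : ℝ) ^ (-s) < 2 ^ (-β) :=
    Real.rpow_lt_rpow_of_exponent_lt (by norm_num) (by linarith)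
  filter_upwards [h.eventually (lt_mem_nhds hlt)] with m hm
  rw [lt_div_iff₀ (hpos m), Real.rpow_neg (by norm_num), inv_mul_lt_iff₀ (by positivity)] at hm
  exact hm.le

lemma eventually_le_two_rpow_neg_mul (hpos : ∀ n, 0 < τ n) {β s : ℝ} (hs : s < β)
    (h : Tendsto (fun n => τ (2 * n) / τ n) atTop (nhds (2 ^ (-β)))) :
    ∀ᶠ m in atTop, τ (2 * m) ≤ 2 ^ (-s) * τ m := by
  have hlt : (2 : ℝ) ^ (-β) < 2 ^ (-s) :=
    Real.rpow_lt_rpow_of_exponent_lt (by norm_num) (by linarith)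
  filter_upwards [h.eventually (gt_mem_nhds hlt)] with m hm
  rw [div_lt_iff₀ (hpos m)] at hm
  exact hm.le

end Tail

section RegularTail

variable {A : Type*} [NormedRing A] [NormedAlgebra ℂ A]

lemma exists_forall_le_mul_of_eventually {f g : ℕ → ℝ} {C : ℝ} (hg : ∀ n, 0 < g n)
    (h : ∀ᶠ n in atTop, f n ≤ C * g n) : ∃ C' : ℝ, 0 < C' ∧ ∀ n, f n ≤ C' * g n := by
  obtain ⟨N, hN⟩ := eventually_atTop.1 h
  have hs : ∀ n, 0 ≤ |f n| / g n := fun n => div_nonneg (abs_nonneg _) (hg n).le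
  have hs' : 0 ≤ ∑ n ∈ Finset.range N, |f n| / g n := Finset.sum_nonneg fun n _ => hs n
  refine ⟨|C| + 1 + ∑ n ∈ Finset.range N, |f n| / g n, by positivity, fun n => ?_⟩
  rcases le_or_gt N n with hn | hn
  · refine (hN n hn).trans (mul_le_mul_of_nonneg_right ?_ (hg n).le)
    linarith [le_abs_self C]
  · rw [← div_le_iff₀ (hg n)]
    have h1 := Finset.single_le_sum (f := fun n => |f n| / g n) (fun n _ => hs n)
      (Finset.mem_range.2 hn)
    have h2 : f n / g n ≤ |f n| / g n := div_le_div_of_nonneg_right (le_abs_self _) (hg n).le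
    have h3 := abs_nonneg C
    linarith

/-- Quantitative regularity of the norms of the coefficients `R n` and of the weights `r n` in
terms of the tail `τ` of `r`. -/
structure RegularTail (R : ℕ → A) (r τ : ℕ → ℝ) (β : ℝ) : Prop where
  pos : ∀ n, 0 < τ n
  sum_le : ∃ C : ℝ, 0 < C ∧ ∀ n, ∑ j ∈ Finset.Icc 1 n, τ j ≤ C * n * τ n
  norm_le : ∃ C : ℝ, 0 < C ∧ ∀ n, n * ‖R n‖ ≤ C * τ n
  tail_le : ∃ C : ℝ, 0 < C ∧ ∀ n, tailSum (fun j => ‖R j‖) n ≤ C * τ n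
  le_coeff : ∃ (c : ℝ) (n₀ : ℕ), 0 < c ∧ ∀ m, n₀ ≤ m → ∀ n ∈ Finset.Ioc m (2 * m),
    c * τ m ≤ m * r n
  rpow_le : ∀ s, β < s → ∃ c : ℝ, 0 < c ∧ ∀ n : ℕ, 1 ≤ n → c * (n : ℝ) ^ (-s) ≤ τ n
  le_rpow : ∀ s, 0 ≤ s → s < β → ∃ C : ℝ, 0 < C ∧ ∀ n : ℕ, τ n ≤ C * ((n : ℝ) + 1) ^ (-s)

variable {β : ℝ} {L τ r : ℕ → ℝ}

lemma tendsto_two_mul_div (hL : SlowlyVaryingSeq L)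
    (h : Tendsto (fun n : ℕ => τ n * (n : ℝ) ^ β / L n) atTop (nhds 1)) :
    Tendsto (fun n => τ (2 * n) / τ n) atTop (nhds (2 ^ (-β))) := by
  have h2 : Tendsto (fun n : ℕ => 2 * n) atTop atTop :=
    tendsto_id.const_mul_atTop' (by norm_num)
  have h3 := ((h.comp h2).div h one_ne_zero).mul ((hL.2 2 two_pos).mul_const ((2 : ℝ) ^ (-β)))
  rw [div_one, one_mul, one_mul] at h3
  refine h3.congr' ?_
  filter_upwards [eventually_ge_atTop 1] with n hn
  have hn' : (0 : ℝ) < n := by exact_mod_cast hn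
  have e : Nat.floor ((2 : ℝ) * n) = 2 * n := by
    rw [← Nat.cast_ofNat, ← Nat.cast_mul, Nat.floor_natCast]
  have hL1 := (hL.1 n).ne'
  have hL2 := (hL.1 (2 * n)).ne'
  simp only [Pi.div_apply, Function.comp_apply, e]
  push_cast
  rw [Real.mul_rpow zero_le_two hn'.le, Real.rpow_neg zero_le_two]
  field_simp

lemma tailSum_pos (hL : ∀ n, 0 < L n) (hr : Summable r) (h0 : ∀ n, 0 ≤ r n)
    (h : Tendsto (fun n : ℕ => tailSum r n * (n : ℝ) ^ β / L n) atTop (nhds 1)) (n : ℕ) :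
    0 < tailSum r n := by
  obtain ⟨m, hm, hnm⟩ := ((h.eventually (lt_mem_nhds one_pos)).and
    (eventually_ge_atTop n)).exists
  refine lt_of_lt_of_le ?_ (antitone_tailSum hr h0 hnm)
  by_contra! hneg
  refine hm.not_ge (div_nonpos_of_nonpos_of_nonneg ?_ (hL m).le)
  exact mul_nonpos_of_nonpos_of_nonneg hneg (by positivity)

/-- If `n r n / τ n` converges, then its limit is positive. -/
lemma pos_of_tendsto_coeff (hr : Summable r) (hβ : 0 < β)
    (hpos : ∀ n, 0 < tailSum r n) (hτ : Antitone (tailSum r))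
    (h2 : Tendsto (fun n => tailSum r (2 * n) / tailSum r n) atTop (nhds (2 ^ (-β)))) {e : ℝ}
    (he : Tendsto (fun n : ℕ => n * r n / tailSum r n) atTop (nhds e)) : 0 < e := by
  have hb : (2 : ℝ) ^ (-β) < 1 := Real.rpow_lt_one_of_one_lt_of_neg (by norm_num) (by linarith)
  by_contra! hle
  obtain ⟨ε, hε, hε'⟩ : ∃ ε : ℝ, 0 < ε ∧ (2 : ℝ) ^ (-β) < 1 - ε :=
    ⟨(1 - 2 ^ (-β)) / 2, by linarith, by linarith⟩
  obtain ⟨N, hN⟩ := eventually_atTop.1 (he.eventually (gt_mem_nhds (hle.trans_lt hε)))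
  obtain ⟨n, hn, hnN⟩ := ((h2.eventually (gt_mem_nhds hε')).and
    (eventually_ge_atTop (N + 1))).exists
  have hn0 : (0 : ℝ) < n := by
    have : 0 < n := by omega
    exact_mod_cast this
  have h3 : ∑ j ∈ Finset.Ioc n (2 * n), r j ≤ ε * tailSum r n := by
    calc _ ≤ ∑ j ∈ Finset.Ioc n (2 * n), ε * tailSum r n / n := by
          refine Finset.sum_le_sum fun j hj => ?_
          rw [Finset.mem_Ioc] at hj
          have h4 := hN j (by omega)
          rw [div_lt_iff₀ (hpos j)] at h4
          have hj' : (n : ℝ) ≤ j := by exact_mod_cast hj.1.le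
          have hj0 : (0 : ℝ) < j := hn0.trans_le hj'
          calc r j ≤ ε * tailSum r j / j := by
                rw [le_div_iff₀ hj0]
                linarith
            _ ≤ ε * tailSum r n / n := by
              have := hτ hj.1.le
              gcongr
              exact (mul_pos hε (hpos n)).le
      _ = ε * tailSum r n := by
        rw [Finset.sum_const, Nat.card_Ioc, nsmul_eq_mul]
        have : 2 * n - n = n := by omega
        rw [this]
        field_simp
  have h4 := tailSum_eq_sum_add hr (by omega : n ≤ 2 * n)
  rw [div_lt_iff₀ (hpos n)] at hn
  linarith

lemma regularTail {R : ℕ → A} {P E : A} (hP : P ≠ 0) (hsum : Summable fun n => ‖R n‖)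
    (hr0 : ∀ n, 0 ≤ r n) (hrP : ∀ n, P * R n * P = (r n : ℂ) • P) (hr : Summable r)
    (hβ : β ∈ Set.Ioo (0 : ℝ) 1) (hL : SlowlyVaryingSeq L)
    (hconv : Tendsto (fun n : ℕ => ((((n : ℝ) ^ (1 + β) / L n : ℝ) : ℂ)) • R n) atTop (nhds E))
    (htail : Tendsto (fun n : ℕ => tailSum r n * (n : ℝ) ^ β / L n) atTop (nhds 1)) :
    RegularTail R r (tailSum r) β := by
  have hpos := tailSum_pos hL.1 hr hr0 htail
  have hanti := antitone_tailSum hr hr0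
  have h2 := tendsto_two_mul_div hL htail
  have hdbl : ∀ s, β < s → ∀ᶠ m in atTop, tailSum r m ≤ 2 ^ s * tailSum r (2 * m) :=
    fun s hs => eventually_le_two_rpow_mul hpos hs h2
  have hquot : ∀ (z : ℕ → ℝ) (w : ℝ),
      Tendsto (fun n : ℕ => (n : ℝ) ^ (1 + β) / L n * z n) atTop (nhds w) →
      Tendsto (fun n : ℕ => n * z n / tailSum r n) atTop (nhds w) := by
    intro z w hz
    have h := hz.div htail one_ne_zero
    rw [div_one] at h
    refine h.congr' ?_
    filter_upwards [eventually_ge_atTop 1] with n hn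
    have hn' : (0 : ℝ) < n := by exact_mod_cast hn
    have hL1 := (hL.1 n).ne'
    have hr := (Real.rpow_pos_of_pos hn' β).ne'
    simp only [Pi.div_apply]
    rw [Real.rpow_add hn', Real.rpow_one]
    field_simp
  have hy : ∀ n : ℕ, 0 ≤ (n : ℝ) ^ (1 + β) / L n := fun n =>
    div_nonneg (by positivity) (hL.1 n).le
  have hnorm : Tendsto (fun n : ℕ => n * ‖R n‖ / tailSum r n) atTop (nhds ‖E‖) := by
    refine hquot _ _ (hconv.norm.congr fun n => ?_)
    rw [norm_smul, Complex.norm_real, Real.norm_of_nonneg (hy n)]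
  have hcoeff : Tendsto (fun n : ℕ => n * r n / tailSum r n) atTop
      (nhds (‖P * E * P‖ / ‖P‖)) := by
    refine hquot _ _ (((((hconv.const_mul P).mul_const P)).norm.div_const ‖P‖).congr fun n => ?_)
    rw [mul_smul_comm, smul_mul_assoc, hrP, norm_smul, norm_smul, Complex.norm_real,
      Complex.norm_real, Real.norm_of_nonneg (hy n), Real.norm_of_nonneg (hr0 n)]
    have := norm_ne_zero_iff.2 hP
    field_simp
  have he := pos_of_tendsto_coeff hr hβ.1 hpos hanti h2 hcoeff
  set e := ‖P * E * P‖ / ‖P‖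
  have hnorm' : ∀ᶠ n : ℕ in atTop, n * ‖R n‖ ≤ (‖E‖ + 1) * tailSum r n := by
    filter_upwards [hnorm.eventually (gt_mem_nhds (lt_add_one ‖E‖))] with n hn
    rw [div_lt_iff₀ (hpos n)] at hn
    exact hn.le
  have hcoeff' : ∀ᶠ n : ℕ in atTop, e / 2 * tailSum r n ≤ n * r n := by
    filter_upwards [hcoeff.eventually (lt_mem_nhds (half_lt_self he))] with n hn
    rw [lt_div_iff₀ (hpos n)] at hn
    exact hn.le
  refine ⟨hpos, ?_, exists_forall_le_mul_of_eventually hpos hnorm', ?_, ?_, fun s hs => ?_,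
    fun s hs0 hs => ?_⟩
  · obtain ⟨s, hs1, hs2⟩ := exists_between hβ.2
    exact exists_sum_le_mul_of_doubling hanti hpos hs2 (hdbl s hs1)
  · refine exists_forall_le_mul_of_eventually (C := (‖E‖ + 1) * (2 / e)) hpos ?_
    obtain ⟨N, hN⟩ := eventually_atTop.1 (hnorm'.and hcoeff')
    filter_upwards [eventually_ge_atTop N] with n hn
    rw [tailSum, tailSum, ← tsum_mul_left]
    refine Summable.tsum_le_tsum (fun j => ?_) ((summable_nat_add_iff (n + 1)).2 hsum)
      (((summable_nat_add_iff (n + 1)).2 hr).mul_left _)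
    obtain ⟨h3, h4⟩ := hN (j + (n + 1)) (by omega)
    have hj : (0 : ℝ) < ((j + (n + 1) : ℕ) : ℝ) := by positivity
    have h5 : tailSum r (j + (n + 1)) ≤ 2 / e * (((j + (n + 1) : ℕ) : ℝ) * r (j + (n + 1))) := by
      rw [div_mul_eq_mul_div, le_div_iff₀ he]
      linarith
    have h6 := h3.trans (mul_le_mul_of_nonneg_left h5 (by positivity))
    refine le_of_mul_le_mul_left (h6.trans (le_of_eq (by ring))) hj
  · obtain ⟨N, hN⟩ := eventually_atTop.1 (hcoeff'.and (hdbl 1 hβ.2))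
    refine ⟨e / 8, N, by positivity, fun m hm n hn => ?_⟩
    rw [Finset.mem_Ioc] at hn
    have h3 := (hN n (by omega)).1
    have h4 := (hN m hm).2
    rw [Real.rpow_one] at h4
    have h5 := hanti hn.2
    have hn2 : (n : ℝ) ≤ 2 * m := by exact_mod_cast hn.2
    have h6 := mul_le_mul_of_nonneg_right hn2 (hr0 n)
    have h7 := mul_le_mul_of_nonneg_left (h4.trans (mul_le_mul_of_nonneg_left h5 zero_le_two)) he.le
    linarith
  · exact exists_rpow_le_of_doubling hanti hpos (hβ.1.trans hs).le (hdbl s hs)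
  · exact exists_le_rpow_of_doubling hanti hpos hs0 (eventually_le_two_rpow_neg_mul hpos hs h2)

end RegularTail

section Smoothing

variable {E : Type*} [NormedAddCommGroup E] [NormedSpace ℂ E] [CompleteSpace E]
variable {r τ : ℕ → ℝ}

lemma wienerBound_chr_one_sub_one : WienerBound (fun t => chr 1 t - 1) 2 :=
  (((wienerBound_chr 1).sub (wienerBound_chr 0)).congr fun t => by rw [chr_zero]).mono
    (by norm_num)

lemma summable_norm_ofReal (hr0 : ∀ n, 0 ≤ r n) (hr : Summable r) :
    Summable fun n => ‖(r n : ℂ)‖ :=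
  hr.congr fun n => by rw [Complex.norm_real, Real.norm_of_nonneg (hr0 n)]

lemma wienerBound_fourierSum_ofReal (hr0 : ∀ n, 0 ≤ r n) {s : ℝ} (hr : HasSum r s) :
    WienerBound (fourierSum fun n => (r n : ℂ)) s := by
  refine (wienerBound_fourierSum (summable_norm_ofReal hr0 hr.summable)).mono (le_of_eq ?_)
  rw [← hr.tsum_eq]
  exact tsum_congr fun n => by rw [Complex.norm_real, Real.norm_of_nonneg (hr0 n)]

lemma sum_Ioc_chr_mul_sub_one (m : ℕ) (t : ℝ) :
    (chr 1 t - 1) * ∑ n ∈ Finset.Ioc m (2 * m), chr n t =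
      chr ((2 * m + 1 : ℕ) : ℤ) t - chr ((m + 1 : ℕ) : ℤ) t := by
  have e : Finset.Ioc m (2 * m) = Finset.Ico (m + 1) (2 * m + 1) := by
    ext j
    simp only [Finset.mem_Ioc, Finset.mem_Ico]
    omega
  simp only [e, chr_natCast]
  rw [mul_comm]
  exact geom_sum_Ico_mul _ (by omega)

/-- Smoothing for powers of the characteristic function of a probability distribution which
dominates a uniform distribution on `(m, 2m]` of mass `p`. -/
lemma wienerBound_chr_sub_one_mul_pow (hr0 : ∀ n, 0 ≤ r n) (hr : HasSum r 1) {m : ℕ} (hm : 1 ≤ m)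
    {p : ℝ} (hp : 0 ≤ p) (hpr : ∀ n ∈ Finset.Ioc m (2 * m), p ≤ m * r n) :
    p ≤ 1 ∧ ∀ i, WienerBound (fun t => (fourierSum (fun n => (r n : ℂ)) t) ^ i * (chr 1 t - 1))
      (2 * (1 - p) ^ i + 2 / m) := by
  have hm0 : (0 : ℝ) < m := by exact_mod_cast hm
  set ρ := fourierSum (fun n => (r n : ℂ))
  let u : ℕ → ℝ := fun n => if n ∈ Finset.Ioc m (2 * m) then p / m else 0
  have hu : HasSum u p := by
    have h : HasSum u (∑ n ∈ Finset.Ioc m (2 * m), u n) :=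
      hasSum_sum_of_ne_finset_zero fun n hn => if_neg hn
    convert h using 1
    rw [Finset.sum_congr rfl fun n hn => if_pos hn, Finset.sum_const, Nat.card_Ioc, nsmul_eq_mul]
    have : 2 * m - m = m := by omega
    rw [this]
    field_simp
  have hq0 : ∀ n, 0 ≤ r n - u n := fun n => by
    simp only [u]
    split_ifs with h
    · rw [sub_nonneg, div_le_iff₀ hm0]
      linarith [hpr n h]
    · simpa using hr0 n
  have hQ := wienerBound_fourierSum_ofReal hq0 (hr.sub hu)
  set Q := fourierSum (fun n => ((r n - u n : ℝ) : ℂ))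
  let U : ℝ → ℂ := fun t => ((m : ℂ)⁻¹ * ∑ n ∈ Finset.Ioc m (2 * m), chr n t)
  have hU : WienerBound (fun t => (chr 1 t - 1) * U t) (2 / m) := by
    have h := ((wienerBound_chr ((2 * m + 1 : ℕ) : ℤ)).sub
      (wienerBound_chr ((m + 1 : ℕ) : ℤ))).const_smul ((m : ℂ)⁻¹)
    refine (h.congr fun t => ?_).mono (le_of_eq ?_)
    · rw [← sum_Ioc_chr_mul_sub_one, smul_eq_mul]
      ring
    · rw [norm_inv, Complex.norm_natCast]
      ring
  have hρ : ∀ t, ρ t = p * U t + Q t := fun t => by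
    have h1 := hasSum_fourierSum (summable_norm_ofReal hr0 hr.summable) t
    have h2 := hasSum_fourierSum (summable_norm_ofReal hq0 (hr.sub hu).summable) t
    have h3 : HasSum (fun n : ℕ => chr n t • (u n : ℂ)) (p * U t) := by
      have h : HasSum (fun n : ℕ => chr n t • (u n : ℂ))
          (∑ n ∈ Finset.Ioc m (2 * m), chr n t • (u n : ℂ)) :=
        hasSum_sum_of_ne_finset_zero fun n hn => by simp only [u, if_neg hn]; simp
      convert h using 1
      simp only [U, Finset.mul_sum]
      refine Finset.sum_congr rfl fun n hn => ?_
      simp only [u, if_pos hn, smul_eq_mul]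
      push_cast
      ring
    refine h1.unique ((h3.add h2).congr_fun fun n => ?_)
    rw [← smul_add, ← Complex.ofReal_add, add_sub_cancel]
  have hρ1 : WienerBound ρ 1 := wienerBound_fourierSum_ofReal hr0 hr
  refine ⟨by linarith [hQ.nonneg], fun i => ?_⟩
  induction i with
  | zero =>
    refine (wienerBound_chr_one_sub_one.congr fun t => by simp).mono ?_
    have : 0 ≤ 2 / (m : ℝ) := by positivity
    simpa using this
  | succ i ih =>
    have h1 := ((hρ1.pow i).mul hU).const_smul (p : ℂ)
    refine ((h1.add (ih.mul hQ)).congr fun t => ?_).mono (le_of_eq ?_)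
    · rw [pow_succ, hρ t, smul_eq_mul]
      ring
    · rw [Complex.norm_real, Real.norm_of_nonneg hp, one_pow]
      ring

lemma exists_rpow_mul_exp_le (γ : ℝ) {c : ℝ} (hc : 0 < c) :
    ∃ C : ℝ, 0 < C ∧ ∀ i : ℕ, ((i : ℝ) + 1) ^ γ *
      Real.exp (-(c * ((i : ℝ) + 1) ^ (-(9 / 10) : ℝ)) * i) ≤ C := by
  have h1 : Tendsto (fun i : ℕ => ((i : ℝ) + 1) ^ (1 / 10 : ℝ)) atTop atTop :=
    (tendsto_rpow_atTop (by norm_num)).comp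
      (tendsto_atTop_add_const_right _ _ tendsto_natCast_atTop_atTop)
  have h2 := (tendsto_rpow_mul_exp_neg_mul_atTop_nhds_zero (10 * γ) c hc).comp h1
  obtain ⟨M, hM⟩ := h2.bddAbove_range
  refine ⟨Real.exp c * max M 1, by positivity, fun i => ?_⟩
  have h3 : (((i : ℝ) + 1) ^ (1 / 10 : ℝ)) ^ (10 * γ) *
    Real.exp (-c * ((i : ℝ) + 1) ^ (1 / 10 : ℝ)) ≤ M := hM ⟨i, rfl⟩
  have hx : (0 : ℝ) < (i : ℝ) + 1 := by positivity
  rw [← Real.rpow_mul hx.le] at h3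
  have e : (1 / 10 : ℝ) * (10 * γ) = γ := by ring
  rw [e] at h3
  have h4 : -(c * ((i : ℝ) + 1) ^ (-(9 / 10) : ℝ)) * i ≤
      c + -c * ((i : ℝ) + 1) ^ (1 / 10 : ℝ) := by
    have h5 : ((i : ℝ) + 1) ^ (1 / 10 : ℝ) = ((i : ℝ) + 1) ^ (-(9 / 10) : ℝ) * (i + 1) := by
      rw [← Real.rpow_add_one hx.ne']
      norm_num
    have h6 : ((i : ℝ) + 1) ^ (-(9 / 10) : ℝ) ≤ 1 :=
      Real.rpow_le_one_of_one_le_of_nonpos (by linarith [Nat.cast_nonneg (α := ℝ) i]) (by norm_num)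
    rw [h5]
    nlinarith
  calc _ ≤ ((i : ℝ) + 1) ^ γ * Real.exp (c + -c * ((i : ℝ) + 1) ^ (1 / 10 : ℝ)) := by gcongr
    _ = Real.exp c * (((i : ℝ) + 1) ^ γ * Real.exp (-c * ((i : ℝ) + 1) ^ (1 / 10 : ℝ))) := by
      rw [Real.exp_add]
      ring
    _ ≤ Real.exp c * max M 1 := by
      gcongr
      exact h3.trans (le_max_left _ _)

end Smoothing

section SmoothingRegular

variable {A : Type*} [NormedRing A] [NormedAlgebra ℂ A] [CompleteSpace A]
variable {β : ℝ} {r τ : ℕ → ℝ} {R : ℕ → A}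

lemma RegularTail.exists_wienerBound_pow_smul (h : RegularTail R r τ β) (hr0 : ∀ n, 0 ≤ r n)
    (hr : HasSum r 1) (hR : Summable fun n => ‖R n‖) {g : ℕ → A} {κ : ℝ} (hκ : 0 ≤ κ)
    (hg : ∀ n, ‖g n‖ ≤ κ * ‖R n‖) (hg0 : fourierSum g 0 = 0) :
    ∃ C : ℝ, 0 ≤ C ∧ ∀ m i : ℕ, 1 ≤ m → ∀ p : ℝ, 0 ≤ p →
      (∀ n ∈ Finset.Ioc m (2 * m), p ≤ m * r n) →
      WienerBound (fun t => (fourierSum (fun n => (r n : ℂ)) t) ^ i • fourierSum g t)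
        (C * τ m * (m * (1 - p) ^ i + 1)) := by
  obtain ⟨C₀, hC₀, hn⟩ := h.norm_le
  obtain ⟨C₁, hC₁, ht⟩ := h.tail_le
  obtain ⟨C₂, hC₂, hs⟩ := h.sum_le
  have hgs : Summable fun n => ‖g n‖ :=
    (hR.mul_left κ).of_nonneg_of_le (fun _ => norm_nonneg _) hg
  refine ⟨2 * κ * (C₀ * C₂ + C₁), by positivity, fun m i hm p hp hpr => ?_⟩
  obtain ⟨hp1, hsm⟩ := wienerBound_chr_sub_one_mul_pow hr0 hr hm hp hpr
  have hρ := (wienerBound_fourierSum_ofReal hr0 hr).pow i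
  have hw := WienerBound.smul_fourierSum_sub hgs hρ (hsm i) (m + 1)
  refine (hw.congr fun t => by rw [hg0, sub_zero]).mono ?_
  have h1 : ∑ n ∈ Finset.range (m + 1), n * ‖g n‖ ≤ κ * C₀ * C₂ * (m * τ m) := by
    calc _ = ∑ n ∈ Finset.Icc 1 m, n * ‖g n‖ := by
          refine (Finset.sum_subset (fun n hn => ?_) fun n _ hn => ?_).symm
          · simp only [Finset.mem_Icc, Finset.mem_range] at hn ⊢
            omega
          · simp only [Finset.mem_Icc, Finset.mem_range] at *
            have : n = 0 := by omega
            simp [this]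
      _ ≤ ∑ n ∈ Finset.Icc 1 m, κ * C₀ * τ n := by
          refine Finset.sum_le_sum fun n _ => ?_
          calc n * ‖g n‖ ≤ n * (κ * ‖R n‖) := by gcongr; exact hg n
            _ = κ * (n * ‖R n‖) := by ring
            _ ≤ κ * (C₀ * τ n) := mul_le_mul_of_nonneg_left (hn n) hκ
            _ = _ := by ring
      _ = κ * C₀ * ∑ n ∈ Finset.Icc 1 m, τ n := by rw [Finset.mul_sum]
      _ ≤ κ * C₀ * (C₂ * m * τ m) := by gcongr; exact hs m
      _ = _ := by ring
  have h2 : ∑' n, ‖g (n + (m + 1))‖ ≤ κ * (C₁ * τ m) := by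
    calc _ ≤ ∑' n, κ * ‖R (n + (m + 1))‖ :=
          Summable.tsum_le_tsum (fun n => hg _) ((summable_nat_add_iff (m + 1)).2 hgs)
            (((summable_nat_add_iff (m + 1)).2 hR).mul_left κ)
      _ = κ * tailSum (fun j => ‖R j‖) m := tsum_mul_left
      _ ≤ _ := by gcongr; exact ht m
  have h4 : 0 ≤ 2 * κ * C₁ * τ m * (m * (1 - p) ^ i) := by
    have := (h.pos m).le
    positivity
  calc _ ≤ (2 * (1 - p) ^ i + 2 / m) * (κ * C₀ * C₂ * (m * τ m)) +
        1 ^ i * (2 * (κ * (C₁ * τ m))) := by gcongr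
    _ = 2 * κ * (C₀ * C₂) * τ m * (m * (1 - p) ^ i + 1) + 2 * κ * C₁ * τ m := by
      field_simp
      ring
    _ ≤ _ := by nlinarith

/-- Multiplying a mean zero Fourier series by high powers of the characteristic function of `r`
makes it small. -/
lemma RegularTail.exists_wienerBound_pow_smul_le_rpow (h : RegularTail R r τ β) (hβ : 0 < β)
    (hr0 : ∀ n, 0 ≤ r n)
    (hr : HasSum r 1) (hR : Summable fun n => ‖R n‖) {g : ℕ → A} {κ : ℝ} (hκ : 0 ≤ κ)
    (hg : ∀ n, ‖g n‖ ≤ κ * ‖R n‖) (hg0 : fourierSum g 0 = 0) :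
    ∃ C : ℝ, 0 ≤ C ∧ ∀ i : ℕ,
      WienerBound (fun t => (fourierSum (fun n => (r n : ℂ)) t) ^ i • fourierSum g t)
        (C * ((i : ℝ) + 1) ^ (-(7 / 10) : ℝ)) := by
  obtain ⟨C, hC, hw⟩ := h.exists_wienerBound_pow_smul hr0 hr hR hκ hg hg0
  obtain ⟨c, n₀, hc, hcoeff⟩ := h.le_coeff
  obtain ⟨c₁, hc₁, hlow⟩ := h.rpow_le (9 * β / 8) (by linarith)
  obtain ⟨C₅, hC₅, hup⟩ := h.le_rpow (7 * β / 8) (by linarith) (by linarith)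
  set γ : ℝ := 4 / (5 * β) with hγ
  have hγ0 : 0 < γ := by positivity
  set c' : ℝ := c * (c₁ * (2 + n₀ : ℝ) ^ (-(9 * β / 8))) with hc'
  have hc'0 : 0 < c' := by positivity
  obtain ⟨C₄, hC₄, hexp⟩ := exists_rpow_mul_exp_le γ hc'0
  refine ⟨C * C₅ * ((2 + n₀) * C₄ + 1), by positivity, fun i => ?_⟩
  set x : ℝ := (i : ℝ) + 1
  have hx1 : 1 ≤ x := by simp [x]
  have hx0 : 0 < x := by linarith
  have hxγ : 1 ≤ x ^ γ := Real.one_le_rpow hx1 hγ0.le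
  let m := ⌈x ^ γ⌉₊ + n₀
  have hm1 : x ^ γ ≤ m := by
    have := Nat.le_ceil (x ^ γ)
    simp only [m]
    push_cast
    linarith [Nat.cast_nonneg (α := ℝ) n₀]
  have hm2 : (m : ℝ) ≤ (2 + n₀) * x ^ γ := by
    have := (Nat.ceil_lt_add_one (by positivity : 0 ≤ x ^ γ)).le
    simp only [m]
    push_cast
    nlinarith [Nat.cast_nonneg (α := ℝ) n₀]
  have hm0 : (0 : ℝ) < m := by linarith
  have hm : 1 ≤ m := by exact_mod_cast hm0
  have hw' := hw m i hm (c * τ m) (mul_pos hc (h.pos m)).le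
    (hcoeff m (Nat.le_add_left _ _))
  have hp1 := (wienerBound_chr_sub_one_mul_pow hr0 hr hm (mul_pos hc (h.pos m)).le
    (hcoeff m (Nat.le_add_left _ _))).1
  refine hw'.mono ?_
  have h1 : τ m ≤ C₅ * x ^ (-(7 / 10) : ℝ) := by
    refine (hup m).trans ?_
    gcongr
    have e : x ^ (-(7 / 10) : ℝ) = (x ^ γ) ^ (-(7 * β / 8)) := by
      rw [← Real.rpow_mul hx0.le]
      congr 1
      rw [hγ]
      field_simp
      norm_num
    rw [e]
    exact Real.rpow_le_rpow_of_nonpos (by linarith) (by linarith) (by linarith)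
  have h2 : c' * x ^ (-(9 / 10) : ℝ) ≤ c * τ m := by
    rw [hc', mul_assoc, mul_assoc]
    gcongr
    refine le_trans ?_ (hlow m hm)
    gcongr
    have e : x ^ (-(9 / 10) : ℝ) = (x ^ γ) ^ (-(9 * β / 8)) := by
      rw [← Real.rpow_mul hx0.le]
      congr 1
      rw [hγ]
      field_simp
      norm_num
    rw [e, ← Real.mul_rpow (by positivity) (by positivity)]
    exact Real.rpow_le_rpow_of_nonpos hm0 hm2 (by linarith)
  have h3 : m * (1 - c * τ m) ^ i ≤ (2 + n₀) * C₄ := by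
    calc _ ≤ ((2 + n₀) * x ^ γ) * (Real.exp (-(c * τ m))) ^ i := by
          gcongr
          exact Real.one_sub_le_exp_neg _
      _ = ((2 + n₀) * x ^ γ) * Real.exp (-(c * τ m) * i) := by
          rw [← Real.exp_nat_mul, mul_comm (i : ℝ)]
      _ ≤ ((2 + n₀) * x ^ γ) * Real.exp (-(c' * x ^ (-(9 / 10) : ℝ)) * i) := by gcongr
      _ = (2 + n₀) * (x ^ γ * Real.exp (-(c' * x ^ (-(9 / 10) : ℝ)) * i)) := by ring
      _ ≤ _ := by gcongr; exact hexp i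
  calc _ ≤ C * (C₅ * x ^ (-(7 / 10) : ℝ)) * ((2 + n₀) * C₄ + 1) := by gcongr
    _ = _ := by ring

end SmoothingRegular

section BlockPowers

variable {A : Type*} [NormedRing A] [NormedAlgebra ℂ A]

lemma pow_mul_eq_add_sum_of_right {M P c : A} {z : ℂ} (h : M * P = z • P + c) (l : ℕ) :
    M ^ l * P = z ^ l • P + ∑ k ∈ Finset.range l, z ^ k • (M ^ (l - 1 - k) * c) := by
  induction l with
  | zero => simp
  | succ l ih =>
    rw [pow_succ, mul_assoc, h, mul_add, mul_smul_comm, ih, Finset.sum_range_succ', smul_add,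
      smul_smul, ← pow_succ', Finset.smul_sum, add_assoc]
    congr 2
    · refine Finset.sum_congr rfl fun k _ => ?_
      rw [smul_smul, ← pow_succ']
      congr 3
      omega
    · simp

lemma pow_mul_eq_add_sum_of_left {A : Type*} [Ring A] {M P b D : A} (hPD : P * D = 0)
    (h : ∀ g, P * g = 0 → M * g = b * g + D * g) (l : ℕ) (g : A) (hg : P * g = 0) :
    M ^ l * g = D ^ l * g + ∑ j ∈ Finset.range l, M ^ (l - 1 - j) * (b * D ^ j * g) := by
  induction l generalizing g with
  | zero => simp
  | succ l ih =>
    have hDg : P * (D * g) = 0 := by rw [← mul_assoc, hPD, zero_mul]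
    rw [pow_succ, mul_assoc, h g hg, mul_add, ih (D * g) hDg, Finset.sum_range_succ', pow_succ D,
      add_comm, add_assoc, mul_assoc (D ^ l)]
    congr 2
    · refine Finset.sum_congr rfl fun j _ => ?_
      rw [pow_succ, mul_assoc, mul_assoc, mul_assoc]
      congr 2
      omega
    · simp

variable [CompleteSpace A]

lemma wienerBound_pow_mul_of_blocks {ρ : ℝ → ℂ} {P : A} {M b c D : ℝ → A} {w d : ℕ → ℝ} {Y : ℝ}
    (hPb : ∀ t, P * b t = b t) (hPc : ∀ t, P * c t = 0)
    (hPD : ∀ t, P * D t = 0) (hMP : ∀ t, M t * P = ρ t • P + c t)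
    (hM : ∀ t g, P * g = 0 → M t * g = b t * g + D t * g)
    (hρ : ∀ k, WienerBound (fun t => ρ t ^ k) 1)
    (hb : ∀ k, WienerBound (fun t => ρ t ^ k • b t) (w k))
    (hc : ∀ k, WienerBound (fun t => ρ t ^ k • c t) (w k))
    (hD : ∀ j, WienerBound (fun t => D t ^ j) (d j)) (hd : Summable d)
    (hw : Summable fun k => w (k / 2) * w (k - k / 2))
    (hsmall : (∑' k, w (k / 2) * w (k - k / 2)) * ∑' j, d j ≤ 1 / 2)
    (hY : 2 * (‖P‖ + (∑' j, d j) * w 0) ≤ Y) (l : ℕ) :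
    WienerBound (fun t => M t ^ l * P) Y := by
  have hd0 : ∀ j, 0 ≤ d j := fun j => (hD j).nonneg
  have hw0 : ∀ k, 0 ≤ w k := fun k => (hb k).nonneg
  have hG : 0 ≤ ∑' j, d j := tsum_nonneg hd0
  have hY0 : 0 ≤ Y := le_trans (by have := hw0 0; positivity) hY
  induction l using Nat.strong_induction_on with
  | _ l ih =>
    have h1 := (hρ l).smul (wienerBound_const P)
    have h2 := WienerBound.sum (Finset.range l) fun k _ =>
      (hρ k).smul ((hD (l - 1 - k)).mul (hc 0))
    have h3 := WienerBound.sum (Finset.range l) fun k hk =>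
      WienerBound.sum (Finset.range (l - 1 - k)) fun j hj =>
        (ih (l - 1 - k - 1 - j) (by
          simp only [Finset.mem_range] at hj hk
          omega)).mul (((hb (k / 2)).mul (hD j)).mul (hc (k - k / 2)))
    refine (((h1.add h2).add h3).congr fun t => ?_).mono ?_
    · rw [pow_mul_eq_add_sum_of_right (hMP t), add_assoc, ← Finset.sum_add_distrib]
      congr 1
      refine Finset.sum_congr rfl fun k hk => ?_
      rw [pow_mul_eq_add_sum_of_left (hPD t) (hM t) _ _ (hPc t), smul_add, pow_zero, one_smul,
        Finset.smul_sum]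
      congr 1
      refine Finset.sum_congr rfl fun j hj => ?_
      have e : ρ t ^ k = ρ t ^ (k / 2) * ρ t ^ (k - k / 2) := by
        rw [← pow_add]
        congr 1
        omega
      have e' : P * (b t * D t ^ j * c t) = b t * D t ^ j * c t := by
        rw [mul_assoc, ← mul_assoc P, hPb]
      simp only [smul_mul_assoc, mul_smul_comm, smul_smul]
      rw [e, mul_comm, mul_assoc _ P, e']
    · have h4 : ∑ k ∈ Finset.range l, 1 * (d (l - 1 - k) * w 0) ≤ (∑' j, d j) * w 0 := by
        simp only [one_mul]
        rw [← Finset.sum_mul, Finset.sum_range_reflect d]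
        exact mul_le_mul_of_nonneg_right (hd.sum_le_tsum _ fun j _ => hd0 j) (hw0 0)
      have h5 : ∑ k ∈ Finset.range l, ∑ j ∈ Finset.range (l - 1 - k),
          Y * (w (k / 2) * d j * w (k - k / 2)) ≤ Y * (1 / 2) := by
        calc _ ≤ ∑ k ∈ Finset.range l, Y * ((w (k / 2) * w (k - k / 2)) * ∑' j, d j) := by
              refine Finset.sum_le_sum fun k _ => ?_
              rw [← Finset.mul_sum]
              gcongr
              have e : ∀ j, w (k / 2) * d j * w (k - k / 2) =
                (w (k / 2) * w (k - k / 2)) * d j := fun j => by ring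
              simp only [e]
              rw [← Finset.mul_sum]
              exact mul_le_mul_of_nonneg_left (hd.sum_le_tsum _ fun j _ => hd0 j)
                (mul_nonneg (hw0 _) (hw0 _))
          _ = Y * ((∑ k ∈ Finset.range l, w (k / 2) * w (k - k / 2)) * ∑' j, d j) := by
              rw [← Finset.mul_sum, Finset.sum_mul]
          _ ≤ Y * ((∑' k, w (k / 2) * w (k - k / 2)) * ∑' j, d j) := by
              gcongr
              exact hw.sum_le_tsum _ fun k _ => mul_nonneg (hw0 _) (hw0 _)
          _ ≤ _ := by gcongr
      linarith

/-- Uniform bounds on the powers of a function with values in block operators, one diagonal block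
being scalar and the other one contracting, when the off-diagonal blocks are small. -/
lemma exists_wienerBound_pow_of_blocks {ρ : ℝ → ℂ} {P : A} {M b c D : ℝ → A} {w d : ℕ → ℝ}
    (hPP : P * P = P) (hPb : ∀ t, P * b t = b t) (hPc : ∀ t, P * c t = 0)
    (hPD : ∀ t, P * D t = 0) (hMP : ∀ t, M t * P = ρ t • P + c t)
    (hM : ∀ t g, P * g = 0 → M t * g = b t * g + D t * g)
    (hρ : ∀ k, WienerBound (fun t => ρ t ^ k) 1)
    (hb : ∀ k, WienerBound (fun t => ρ t ^ k • b t) (w k))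
    (hc : ∀ k, WienerBound (fun t => ρ t ^ k • c t) (w k))
    (hD : ∀ j, WienerBound (fun t => D t ^ j) (d j)) (hd : Summable d)
    (hw : Summable fun k => w (k / 2) * w (k - k / 2))
    (hsmall : (∑' k, w (k / 2) * w (k - k / 2)) * ∑' j, d j ≤ 1 / 2) :
    ∃ K, ∀ l, WienerBound (fun t => M t ^ l) K := by
  have hd0 : ∀ j, 0 ≤ d j := fun j => (hD j).nonneg
  have hV := wienerBound_pow_mul_of_blocks hPb hPc hPD hMP hM hρ hb hc hD hd hw hsmall le_rfl
  set Y := 2 * (‖P‖ + (∑' j, d j) * w 0)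
  have hY := (hV 0).nonneg
  have hw0 := (hb 0).nonneg
  have hPf : P * (1 - P) = 0 := by rw [mul_sub, mul_one, hPP, sub_self]
  refine ⟨Y + ((∑' j, d j) * ‖1 - P‖ + Y * (w 0 * (∑' j, d j) * ‖1 - P‖)), fun l => ?_⟩
  have h1 := (hD l).mul (wienerBound_const (1 - P))
  have h2 := WienerBound.sum (Finset.range l) fun j _ =>
    (hV (l - 1 - j)).mul (((hb 0).mul (hD j)).mul (wienerBound_const (1 - P)))
  refine (((hV l).add (h1.add h2)).congr fun t => ?_).mono ?_
  · have e : M t ^ l = M t ^ l * P + M t ^ l * (1 - P) := by rw [← mul_add]; simp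
    refine Eq.trans ?_ e.symm
    rw [pow_mul_eq_add_sum_of_left (hPD t) (hM t) _ _ hPf]
    refine congrArg _ (congrArg _ (Finset.sum_congr rfl fun j _ => ?_))
    rw [pow_zero, one_smul, mul_assoc _ P, ← mul_assoc P, ← mul_assoc P, hPb]
  · have h3 : ∑ j ∈ Finset.range l, d j ≤ ∑' j, d j := hd.sum_le_tsum _ fun j _ => hd0 j
    rw [← Finset.mul_sum, ← Finset.sum_mul, ← Finset.mul_sum]
    gcongr
    exact hd.le_tsum l fun j _ => hd0 j

lemma exists_summable_min_mul_min (C : ℝ) (hC : 0 ≤ C) {η : ℝ} (hη : 0 < η) :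
    ∃ δ : ℝ, 0 < δ ∧ ∀ w : ℕ → ℝ, (∀ k : ℕ, w k = min δ (C * ((k : ℝ) + 1) ^ (-(7 / 10) : ℝ))) →
      (Summable fun k => w (k / 2) * w (k - k / 2)) ∧
        ∑' k, w (k / 2) * w (k - k / 2) < η := by
  let w : ℕ → ℕ → ℝ := fun n k => min (1 / ((n : ℝ) + 1)) (C * ((k : ℝ) + 1) ^ (-(7 / 10) : ℝ))
  have hw0 : ∀ n k, 0 ≤ w n k := fun n k => le_min (by positivity) (by positivity)
  let B : ℕ → ℝ := fun k => (C * 2 ^ (7 / 10 : ℝ)) ^ 2 * ((k : ℝ) + 1) ^ (-(7 / 5) : ℝ)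
  have hB : Summable B := by
    refine Summable.mul_left _ ?_
    have h := (summable_nat_add_iff (f := fun k : ℕ => (k : ℝ) ^ (-(7 / 5) : ℝ)) 1).2
      (Real.summable_nat_rpow.2 (by norm_num : (-(7 / 5) : ℝ) < -1))
    simpa using h
  have hle : ∀ n k j : ℕ, k ≤ 2 * j + 1 →
      w n j ≤ C * 2 ^ (7 / 10 : ℝ) * ((k : ℝ) + 1) ^ (-(7 / 10) : ℝ) := by
    intro n k j hkj
    refine (min_le_right _ _).trans ?_
    have hkj' : (k : ℝ) ≤ 2 * j + 1 := by exact_mod_cast hkj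
    rw [mul_assoc]
    gcongr
    have e : (2 : ℝ) ^ (7 / 10 : ℝ) = ((1 / 2 : ℝ)) ^ (-(7 / 10) : ℝ) := by
      rw [one_div, Real.inv_rpow zero_le_two, Real.rpow_neg zero_le_two, inv_inv]
    rw [e, ← Real.mul_rpow (by norm_num) (by positivity)]
    exact Real.rpow_le_rpow_of_nonpos (by positivity) (by linarith) (by norm_num)
  have hbd : ∀ n k, w n (k / 2) * w n (k - k / 2) ≤ B k := by
    intro n k
    refine (mul_le_mul (hle n k _ (by omega)) (hle n k _ (by omega)) (hw0 _ _)
      (by positivity)).trans (le_of_eq ?_)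
    have e : ((k : ℝ) + 1) ^ (-(7 / 5) : ℝ) = (((k : ℝ) + 1) ^ (-(7 / 10) : ℝ)) ^ 2 := by
      rw [← Real.rpow_natCast, ← Real.rpow_mul (by positivity)]
      norm_num
    simp only [B, e]
    ring
  have hlim : Tendsto (fun n => ∑' k, w n (k / 2) * w n (k - k / 2)) atTop
      (nhds (∑' _ : ℕ, (0 : ℝ))) := by
    refine tendsto_tsum_of_dominated_convergence hB (fun k => ?_) (Eventually.of_forall
      fun n k => ?_)
    · have h1 : ∀ j, Tendsto (fun n => w n j) atTop (nhds 0) := fun j =>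
        squeeze_zero (fun n => hw0 n j) (fun n => min_le_left _ _)
          tendsto_one_div_add_atTop_nhds_zero_nat
      simpa using (h1 (k / 2)).mul (h1 (k - k / 2))
    · rw [Real.norm_of_nonneg (mul_nonneg (hw0 _ _) (hw0 _ _))]
      exact hbd n k
  rw [tsum_zero] at hlim
  obtain ⟨n, hn⟩ := (hlim.eventually (gt_mem_nhds hη)).exists
  refine ⟨1 / ((n : ℝ) + 1), by positivity, fun w' hw' => ?_⟩
  have e : w' = w n := funext hw'
  rw [e]
  exact ⟨hB.of_nonneg_of_le (fun k => mul_nonneg (hw0 _ _) (hw0 _ _)) (hbd n), hn⟩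

end BlockPowers

section LocalBound

variable {A : Type*} [NormedRing A] [NormedAlgebra ℂ A]

/-- Near `t₀`, the powers of `F` are uniformly bounded in the Wiener norm. -/
def LocallyPowerBounded (F : ℝ → A) (t₀ : ℝ) : Prop :=
  ∃ (χ : ℝ → ℂ) (K₀ K : ℝ), WienerBound χ K₀ ∧ (∀ᶠ t in nhds t₀, χ t = 1) ∧
    ∀ l, WienerBound (fun t => χ t • F t ^ l) K

lemma WienerBound.min {F : ℝ → A} {K K' : ℝ} (h : WienerBound F K) (h' : WienerBound F K') :
    WienerBound F (min K K') := by
  rcases min_choice K K' with e | e <;> rw [e] <;> assumption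

variable [CompleteSpace A]

lemma fourierSum_mul_mul {f : ℕ → A} (hf : Summable fun n => ‖f n‖) (a b : A) (t : ℝ) :
    fourierSum (fun n => a * f n * b) t = a * fourierSum f t * b := by
  refine HasSum.tsum_eq ((((hasSum_fourierSum hf t).mul_left a).mul_right b).congr_fun fun n => ?_)
  rw [mul_smul_comm, smul_mul_assoc]

lemma locallyPowerBounded_of_eq {F X : ℝ → A} {χ : ℝ → ℂ} {t₀ K₀ K : ℝ} (hχ : WienerBound χ K₀)
    (hχ1 : ∀ᶠ t in nhds 0, χ t = 1) (hX : ∀ t, χ (t - t₀) ≠ 0 → X t = F t)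
    (hK : ∀ l, WienerBound (fun t => X t ^ l) K) : LocallyPowerBounded F t₀ := by
  have hχ' : WienerBound (fun t => χ (t - t₀)) K₀ := hχ.translate (-t₀)
  refine ⟨fun t => χ (t - t₀), K₀, K₀ * K, hχ', ?_, fun l => (hχ'.smul (hK l)).congr fun t => ?_⟩
  · have h : Tendsto (fun t => t - t₀) (nhds t₀) (nhds 0) := by
      simpa using (continuous_id.sub continuous_const).tendsto (f := fun t => t - t₀) t₀
    exact h.eventually hχ1
  · by_cases h : χ (t - t₀) = 0
    · simp only [h, zero_smul]
    · simp only [hX t h]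

lemma locallyPowerBounded_of_spectralRadius_lt_one {f : ℕ → A} (hf : Summable fun n => ‖f n‖)
    {t₀ : ℝ} (h : spectralRadius ℂ (fourierSum f t₀) < 1) :
    LocallyPowerBounded (fourierSum f) t₀ := by
  obtain ⟨φ, η, hφ, hφ', hη, hφ1, hφφ⟩ := exists_cutoff
  obtain ⟨C, q, hC, hq0, hq1, ha⟩ := exists_norm_pow_le_of_spectralRadius_lt_one h
  obtain ⟨ε, hε, hε'⟩ : ∃ ε : ℝ, 0 < ε ∧ q + C * ε ≤ 1 := by
    refine ⟨(1 - q) / (C + 1), div_pos (by linarith) (by linarith), ?_⟩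
    have : C * ((1 - q) / (C + 1)) ≤ 1 - q := by
      rw [mul_div_assoc', div_le_iff₀ (by linarith)]
      nlinarith
    linarith
  obtain ⟨k, hk⟩ := exists_localization hφ hφ' hη hf t₀ hε
  refine locallyPowerBounded_of_eq (hφ (k + 1)) (hφ1 (k + 1)) (K := C) (fun t ht => ?_)
    fun l => (WienerBound.const_add_pow ha hk l).mono ?_
  · rw [hφφ k _ ht, one_smul, add_sub_cancel]
  · exact mul_le_of_le_one_right hC (pow_le_one₀ (by positivity) hε')

variable {β : ℝ} {r τ : ℕ → ℝ} {R : ℕ → A}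

lemma RegularTail.locallyPowerBounded (h : RegularTail R r τ β) (hβ : 0 < β) (hr0 : ∀ n, 0 ≤ r n)
    (hr : HasSum r 1) (hR : Summable fun n => ‖R n‖) {P : A} (hPP : P * P = P)
    (hRP : fourierSum R 0 * P = P) (hPR : P * fourierSum R 0 = P)
    (hrP : ∀ n, P * R n * P = (r n : ℂ) • P)
    (hspec : spectralRadius ℂ (fourierSum R 0 * (1 - P)) < 1) {t₀ : ℝ} (ht₀ : chr 1 t₀ = 1) :
    LocallyPowerBounded (fourierSum R) t₀ := by
  obtain ⟨φ, η, hφ, hφ', hη, hφ1, hφφ⟩ := exists_cutoff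
  obtain ⟨C, q, hC, hq0, hq1, ha⟩ := exists_norm_pow_le_of_spectralRadius_lt_one hspec
  set F := fourierSum R
  set f := 1 - P with hf
  set T := F 0 with hT
  set ρ := fourierSum (fun n => (r n : ℂ))
  have hPf : P * f = 0 := by rw [hf, mul_sub, mul_one, hPP, sub_self]
  have hfP : f * P = 0 := by rw [hf, sub_mul, one_mul, hPP, sub_self]
  have hsplit : P + f = 1 := by rw [hf, add_sub_cancel]
  have hFt₀ : F t₀ = T := by
    simp only [hT, F, fourierSum, chr_natCast, ht₀, chr_at_zero, one_pow]
  have hbound : ∀ (a b : A) (n : ℕ), ‖a * R n * b‖ ≤ ‖a‖ * ‖b‖ * ‖R n‖ := fun a b n =>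
    ((norm_mul_le _ _).trans (mul_le_mul_of_nonneg_right (norm_mul_le _ _)
      (norm_nonneg _))).trans (le_of_eq (by ring))
  have hb0 : fourierSum (fun n => P * R n * f) 0 = 0 := by
    rw [fourierSum_mul_mul hR]
    change P * T * f = 0
    rw [hPR, hPf]
  have hc0 : fourierSum (fun n => f * R n * P) 0 = 0 := by
    rw [fourierSum_mul_mul hR, mul_assoc]
    change f * (T * P) = 0
    rw [hRP, hfP]
  obtain ⟨Cb, hCb, hb⟩ := h.exists_wienerBound_pow_smul_le_rpow hβ hr0 hr hR (by positivity)
    (hbound P f) hb0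
  obtain ⟨Cc, hCc, hc⟩ := h.exists_wienerBound_pow_smul_le_rpow hβ hr0 hr hR (by positivity)
    (hbound f P) hc0
  set Q := (1 + q) / 2 with hQ
  have hQ0 : 0 ≤ Q := by linarith
  have hQ1 : Q < 1 := by linarith
  have hd : Summable fun j => C * Q ^ j := (summable_geometric_of_lt_one hQ0 hQ1).mul_left C
  set G := ∑' j, C * Q ^ j
  have hG : 0 ≤ G := tsum_nonneg fun j => by positivity
  obtain ⟨δ, hδ, hw⟩ := exists_summable_min_mul_min (3 * (Cb + Cc)) (by positivity)
    (η := 1 / (2 * (G + 1))) (by positivity)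
  obtain ⟨hws, hwG⟩ := hw _ fun k => rfl
  have hδ' : 0 < δ / (‖P‖ * ‖f‖ + 1) := div_pos hδ (by positivity)
  have hq' : 0 < (1 - q) / 2 / (C * (‖f‖ * ‖f‖) + 1) :=
    div_pos (by linarith) (by positivity)
  obtain ⟨ε, hε, hε1, hε2⟩ : ∃ ε : ℝ, 0 < ε ∧ ‖P‖ * ‖f‖ * ε ≤ δ ∧
      q + C * (‖f‖ * ‖f‖ * ε) ≤ Q := by
    refine ⟨min (δ / (‖P‖ * ‖f‖ + 1)) ((1 - q) / 2 / (C * (‖f‖ * ‖f‖) + 1)),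
      lt_min hδ' hq', ?_, ?_⟩
    · calc _ ≤ (‖P‖ * ‖f‖ + 1) * (δ / (‖P‖ * ‖f‖ + 1)) := by
            gcongr
            · linarith
            · exact min_le_left _ _
        _ = δ := by field_simp
    · have h1 : C * (‖f‖ * ‖f‖) * min (δ / (‖P‖ * ‖f‖ + 1)) ((1 - q) / 2 / (C * (‖f‖ * ‖f‖) + 1)) ≤
          (1 - q) / 2 := by
        calc _ ≤ (C * (‖f‖ * ‖f‖) + 1) * ((1 - q) / 2 / (C * (‖f‖ * ‖f‖) + 1)) := by
              gcongr
              · linarith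
              · exact min_le_right _ _
          _ = (1 - q) / 2 := by field_simp
      rw [← mul_assoc]
      linarith
  obtain ⟨k, hk⟩ := exists_localization hφ hφ' hη hR t₀ hε
  change WienerBound (fun t => φ k (t - t₀) • (F t - F t₀)) ε at hk
  rw [hFt₀] at hk
  set H : ℝ → A := fun t => φ k (t - t₀) • (F t - T) with hH
  have hφk : WienerBound (fun t => φ k (t - t₀)) 3 := (hφ k).translate (-t₀)
  have hρ : ∀ i, WienerBound (fun t => ρ t ^ i) 1 := fun i => by
    simpa only [one_pow] using (wienerBound_fourierSum_ofReal hr0 hr).pow i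
  have hcorner : ∀ (a b : A), a * T * b = 0 → ‖a‖ * ‖b‖ * ε ≤ δ → ∀ C', C' ≤ Cb + Cc →
      (∀ i : ℕ, WienerBound (fun t => ρ t ^ i • fourierSum (fun n => a * R n * b) t)
        (C' * ((i : ℝ) + 1) ^ (-(7 / 10) : ℝ))) → ∀ i : ℕ,
      WienerBound (fun t => ρ t ^ i • (a * H t * b))
        (min δ (3 * (Cb + Cc) * ((i : ℝ) + 1) ^ (-(7 / 10) : ℝ))) := by
    intro a b hab hδab C' hC' hw' i
    refine WienerBound.min ?_ ?_
    · refine ((hρ i).smul (((wienerBound_const a).mul hk).mul (wienerBound_const b))).mono ?_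
      linarith
    · refine ((hφk.smul (hw' i)).congr fun t => ?_).mono ?_
      · rw [fourierSum_mul_mul hR, smul_comm, hH]
        change ρ t ^ i • φ k (t - t₀) • (a * F t * b) = _
        rw [mul_smul_comm, smul_mul_assoc, mul_sub, sub_mul, hab, sub_zero]
      · rw [mul_assoc 3]
        gcongr
  have hD : ∀ j, WienerBound (fun t => (T * f + f * H t * f) ^ j) (C * Q ^ j) := fun j => by
    have h1 := ((wienerBound_const f).mul hk).mul (wienerBound_const f)
    refine (WienerBound.const_add_pow ha h1 j).mono ?_
    have e : ‖f‖ * ε * ‖f‖ = ‖f‖ * ‖f‖ * ε := by ring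
    rw [e]
    gcongr
  have hPT : P * (T * f) = 0 := by rw [← mul_assoc, hPR, hPf]
  have hPfx : ∀ x : A, P * (f * x) = 0 := fun x => by rw [← mul_assoc, hPf, zero_mul]
  have hPPx : ∀ x : A, P * (P * x) = P * x := fun x => by rw [← mul_assoc, hPP]
  obtain ⟨K, hK⟩ := exists_wienerBound_pow_of_blocks (ρ := ρ) (P := P)
    (M := fun t => ρ t • P + P * H t * f + f * H t * P + (T * f + f * H t * f))
    (b := fun t => P * H t * f) (c := fun t => f * H t * P) (D := fun t => T * f + f * H t * f)
    hPP (fun t => by simp only [mul_assoc, hPPx]) (fun t => by simp only [mul_assoc, hPfx])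
    (fun t => by simp only [mul_add, mul_assoc, hPfx, hPT, add_zero])
    (fun t => by
      simp only [add_mul, mul_assoc, smul_mul_assoc, hPP, hfP, mul_zero, add_zero])
    (fun t g hg => by
      simp only [add_mul, mul_assoc, smul_mul_assoc, hg, mul_zero, smul_zero, zero_add, add_zero])
    hρ
    (hcorner P f (by rw [hPR, hPf]) hε1 Cb (by linarith) hb)
    (hcorner f P (by rw [mul_assoc, hRP, hfP]) (by linarith [mul_comm ‖P‖ ‖f‖]) Cc
      (by linarith) hc)
    hD hd hws (by
      have h1 := mul_le_mul_of_nonneg_right hwG.le hG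
      refine h1.trans ?_
      rw [div_mul_eq_mul_div, div_le_div_iff₀ (by positivity) (by positivity)]
      linarith)
  refine locallyPowerBounded_of_eq (hφ (k + 1)) (hφ1 (k + 1)) (fun t ht => ?_) hK
  have hρP : ρ t • P = P * F t * P := by
    refine HasSum.unique ?_ (((hasSum_fourierSum hR t).mul_left P).mul_right P)
    refine ((hasSum_fourierSum (summable_norm_ofReal hr0 hr.summable) t).smul_const P).congr_fun
      fun n => ?_
    rw [mul_smul_comm, smul_mul_assoc, hrP, smul_assoc]
  have hHt : H t = F t - T := by
    simp only [hH, hφφ k _ ht, one_smul]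
  have hTf : T * f = f * T * f := by
    have : T * f = (P + f) * (T * f) := by rw [hsplit, one_mul]
    rw [this, add_mul, hPT, zero_add, mul_assoc]
  have hPTf : P * T * f = 0 := by rw [hPR, hPf]
  have hfTP : f * T * P = 0 := by rw [mul_assoc, hRP, hfP]
  simp only [hHt, hρP, mul_sub, sub_mul, hPTf, hfTP, sub_zero]
  rw [hTf, add_sub_cancel]
  calc _ = (P + f) * F t * (P + f) := by noncomm_ring
    _ = F t := by rw [hsplit, one_mul, mul_one]

end LocalBound

section Gluing

variable {A : Type*} [NormedRing A] [NormedAlgebra ℂ A] [CompleteSpace A]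

lemma exists_wienerBound_pow_of_locallyPowerBounded {F : ℝ → A} {s : Set ℝ} (hs : IsCompact s)
    (h : ∀ t ∈ s, LocallyPowerBounded F t) :
    ∃ (χ : ℝ → ℂ) (K₀ K : ℝ), WienerBound χ K₀ ∧ (∀ t ∈ s, χ t = 1) ∧
      ∀ l, WienerBound (fun t => χ t • F t ^ l) K := by
  refine hs.induction_on (p := fun s => ∃ (χ : ℝ → ℂ) (K₀ K : ℝ), WienerBound χ K₀ ∧
    (∀ t ∈ s, χ t = 1) ∧ ∀ l, WienerBound (fun t => χ t • F t ^ l) K) ?_ ?_ ?_ ?_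
  · refine ⟨fun _ => 0, _, _, wienerBound_const 0, by simp, fun l =>
      (wienerBound_const (0 : A)).congr fun t => (zero_smul ℂ _).symm⟩
  · rintro s t hst ⟨χ, K₀, K, h1, h2, h3⟩
    exact ⟨χ, K₀, K, h1, fun x hx => h2 x (hst hx), h3⟩
  · rintro s t ⟨χ, K₀, K, h1, h2, h3⟩ ⟨χ', K₀', K', h1', h2', h3'⟩
    refine ⟨fun x => χ x + χ' x - χ x * χ' x, _, _, (h1.add h1').sub (h1.mul h1'), ?_, fun l =>
      (((h3 l).add (h3' l)).sub (h1.smul (h3' l))).congr fun x => ?_⟩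
    · rintro x (hx | hx)
      · simp [h2 x hx]
      · simp [h2' x hx]
    · simp only [sub_smul, add_smul, mul_smul]
  · intro x hx
    obtain ⟨χ, K₀, K, h1, h2, h3⟩ := h x hx
    exact ⟨_, mem_nhdsWithin_of_mem_nhds h2, χ, K₀, K, h1, fun t ht => ht, h3⟩

variable {R : ℕ → A} {u : ℕ → ℕ → A}

lemma fourierSum_convolution_pow (hR : Summable fun n => ‖R n‖)
    (hu0 : ∀ n, u 0 n = if n = 0 then 1 else 0)
    (hu : ∀ l n, u (l + 1) n = ∑ k ∈ Finset.range (n + 1), u l k * R (n - k)) (l : ℕ) :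
    (Summable fun n => ‖u l n‖) ∧ ∀ t, fourierSum (u l) t = fourierSum R t ^ l := by
  induction l with
  | zero =>
    constructor
    · refine summable_of_ne_finset_zero (s := {0}) fun n hn => ?_
      rw [hu0, if_neg (by simpa using hn), norm_zero]
    · intro t
      rw [fourierSum, tsum_eq_single 0 fun n hn => by rw [hu0, if_neg hn, smul_zero], hu0,
        if_pos rfl, pow_zero, Nat.cast_zero, chr_zero, one_smul]
  | succ l ih =>
    obtain ⟨h1, h2⟩ := ih
    constructor
    · simpa only [hu] using summable_norm_sum_mul_range_of_summable_norm h1 hR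
    · intro t
      have hn : ∀ {f : ℕ → A}, (Summable fun n => ‖f n‖) →
          Summable fun n : ℕ => ‖chr n t • f n‖ := fun hf => by
        simpa only [norm_smul, norm_chr, one_mul] using hf
      rw [pow_succ, ← h2, fourierSum, fourierSum, fourierSum,
        tsum_mul_tsum_eq_tsum_sum_range_of_summable_norm (hn h1) (hn hR)]
      refine tsum_congr fun n => ?_
      rw [hu, Finset.smul_sum]
      refine Finset.sum_congr rfl fun k hk => ?_
      have hkn : (n : ℤ) = (k : ℤ) + ((n - k : ℕ) : ℤ) := by
        have := Finset.mem_range.1 hk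
        omega
      rw [smul_mul_smul_comm, ← chr_add, ← hkn]

lemma sum_norm_convolution_pow_le (hR : Summable fun n => ‖R n‖)
    (hu0 : ∀ n, u 0 n = if n = 0 then 1 else 0)
    (hu : ∀ l n, u (l + 1) n = ∑ k ∈ Finset.range (n + 1), u l k * R (n - k))
    (h : ∀ t, LocallyPowerBounded (fourierSum R) t) :
    ∃ K : ℝ, 0 ≤ K ∧ ∀ l n, ∑ m ∈ Finset.range n, ‖u l m‖ ≤ K := by
  obtain ⟨χ, K₀, K, -, hχ, hK⟩ := exists_wienerBound_pow_of_locallyPowerBounded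
    (isCompact_Icc (a := (0 : ℝ)) (b := 1)) fun t _ => h t
  refine ⟨K, (hK 0).nonneg, fun l n => ?_⟩
  obtain ⟨h1, h2⟩ := fourierSum_convolution_pow hR hu0 hu l
  have key : ∀ m : ℕ, ∫ t in (0 : ℝ)..1, chr (-m) t • χ t • fourierSum R t ^ l = u l m := by
    intro m
    have hF : ∀ t, HasSum (fun i : ℕ => chr i t • u l i) (fourierSum R t ^ l) := fun t => by
      rw [← h2]
      exact hasSum_fourierSum h1 t
    have h3 := hasSum_fourierCoeff_aux (ν := fun i : ℕ => (i : ℤ)) h1 hF m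
    have h4 := (hasSum_ite_eq m (u l m)).congr_fun
      (g := fun i : ℕ => if (i : ℤ) = m then u l i else 0) fun i => by
        simp only [Nat.cast_inj]
        split_ifs with e
        · rw [e]
        · rfl
    rw [← h3.unique h4]
    refine intervalIntegral.integral_congr fun t ht => ?_
    rw [Set.uIcc_of_le zero_le_one] at ht
    simp only [hχ t ht, one_smul]
  have h5 := (hK l).sum_norm_integral_le ((Finset.range n).map Nat.castEmbedding)
  simpa only [Finset.sum_map, Nat.castEmbedding_apply, key] using h5

end Gluing

section SecondDerivative

open PowerSeries

variable {A : Type*} [NormedRing A]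

/-- The derivation `X d/dX` of power series over a possibly noncommutative ring. -/
def eulerD (f : A⟦X⟧) : A⟦X⟧ := PowerSeries.mk fun n => n • coeff n f

lemma coeff_eulerD (f : A⟦X⟧) (n : ℕ) : coeff n (eulerD f) = n • coeff n f := coeff_mk _ _

lemma eulerD_mul (f g : A⟦X⟧) : eulerD (f * g) = eulerD f * g + f * eulerD g := by
  ext n
  rw [coeff_eulerD, map_add, coeff_mul, coeff_mul, coeff_mul, ← Finset.sum_add_distrib,
    Finset.smul_sum]
  refine Finset.sum_congr rfl fun p hp => ?_
  rw [coeff_eulerD, coeff_eulerD, smul_mul_assoc, mul_smul_comm, ← add_smul,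
    Finset.HasAntidiagonal.mem_antidiagonal.1 hp]

lemma eulerD_sum {ι : Type*} (s : Finset ι) (f : ι → A⟦X⟧) :
    eulerD (∑ i ∈ s, f i) = ∑ i ∈ s, eulerD (f i) := by
  ext n
  simp only [coeff_eulerD, map_sum, Finset.smul_sum]

lemma eulerD_pow (f : A⟦X⟧) (l : ℕ) :
    eulerD (f ^ l) = ∑ i ∈ Finset.range l, f ^ i * eulerD f * f ^ (l - 1 - i) := by
  induction l with
  | zero =>
    ext n
    rw [coeff_eulerD, pow_zero, coeff_one, Finset.range_zero, Finset.sum_empty, map_zero]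
    split_ifs with h <;> simp [h]
  | succ l ih =>
    rw [pow_succ, eulerD_mul, ih, Finset.sum_range_succ, Finset.sum_mul]
    congr 1
    · refine Finset.sum_congr rfl fun i hi => ?_
      have := Finset.mem_range.1 hi
      rw [mul_assoc, ← pow_succ, show l - 1 - i + 1 = l + 1 - 1 - i by omega]
    · rw [show l + 1 - 1 - l = 0 by omega, pow_zero, mul_one]

lemma norm_coeff_mul_le_left {f g : A⟦X⟧} {n : ℕ} {K S : ℝ} (hS0 : 0 ≤ S)
    (hf : ∑ m ∈ Finset.range (n + 1), ‖coeff m f‖ ≤ K) (hg : ∀ m ≤ n, ‖coeff m g‖ ≤ S) :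
    ∀ m ≤ n, ‖coeff m (f * g)‖ ≤ K * S := by
  intro m hm
  rw [coeff_mul, Finset.Nat.sum_antidiagonal_eq_sum_range_succ_mk]
  calc _ ≤ ∑ k ∈ Finset.range (m + 1), ‖coeff k f‖ * S := by
        refine norm_sum_le_of_le _ fun k _ => (norm_mul_le _ _).trans ?_
        gcongr
        exact hg _ (by dsimp only; omega)
    _ ≤ ∑ k ∈ Finset.range (n + 1), ‖coeff k f‖ * S :=
        Finset.sum_le_sum_of_subset_of_nonneg (Finset.range_mono (by omega)) fun _ _ _ => by
          positivity
    _ ≤ K * S := by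
        rw [← Finset.sum_mul]
        gcongr

lemma norm_coeff_mul_le_right {f g : A⟦X⟧} {n : ℕ} {K S : ℝ} (hS0 : 0 ≤ S)
    (hf : ∀ m ≤ n, ‖coeff m f‖ ≤ S) (hg : ∑ m ∈ Finset.range (n + 1), ‖coeff m g‖ ≤ K) :
    ∀ m ≤ n, ‖coeff m (f * g)‖ ≤ S * K := by
  intro m hm
  rw [coeff_mul, ← Finset.Nat.sum_antidiagonal_swap,
    Finset.Nat.sum_antidiagonal_eq_sum_range_succ_mk]
  calc _ ≤ ∑ k ∈ Finset.range (m + 1), S * ‖coeff k g‖ := by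
        refine norm_sum_le_of_le _ fun k _ => (norm_mul_le _ _).trans ?_
        dsimp only [Prod.swap]
        gcongr
        exact hf _ (by omega)
    _ ≤ ∑ k ∈ Finset.range (n + 1), S * ‖coeff k g‖ :=
        Finset.sum_le_sum_of_subset_of_nonneg (Finset.range_mono (by omega)) fun _ _ _ => by
          positivity
    _ ≤ S * K := by
        rw [← Finset.mul_sum]
        gcongr

lemma sum_norm_coeff_mul_le {f g : A⟦X⟧} {n : ℕ} {K K' : ℝ}
    (hf : ∑ m ∈ Finset.range n, ‖coeff m f‖ ≤ K) (hg : ∑ m ∈ Finset.range n, ‖coeff m g‖ ≤ K') :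
    ∑ m ∈ Finset.range n, ‖coeff m (f * g)‖ ≤ K * K' := by
  calc _ ≤ ∑ m ∈ Finset.range n, ∑ k ∈ Finset.range (m + 1), ‖coeff k f‖ * ‖coeff (m - k) g‖ := by
        refine Finset.sum_le_sum fun m _ => ?_
        rw [coeff_mul, Finset.Nat.sum_antidiagonal_eq_sum_range_succ_mk]
        exact norm_sum_le_of_le _ fun k _ => norm_mul_le _ _
    _ = ∑ m ∈ Finset.range n, ∑ k ∈ Finset.range (n - m), ‖coeff m f‖ * ‖coeff k g‖ :=
        Finset.sum_range_diag_flip n fun k j => ‖coeff k f‖ * ‖coeff j g‖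
    _ ≤ ∑ m ∈ Finset.range n, ∑ k ∈ Finset.range n, ‖coeff m f‖ * ‖coeff k g‖ :=
        Finset.sum_le_sum fun m _ => Finset.sum_le_sum_of_subset_of_nonneg
          (Finset.range_mono (Nat.sub_le _ _)) fun _ _ _ => by positivity
    _ ≤ K * K' := by
        rw [← Finset.sum_mul_sum]
        exact mul_le_mul hf hg (Finset.sum_nonneg fun _ _ => norm_nonneg _)
          ((Finset.sum_nonneg fun _ _ => norm_nonneg _).trans hf)

/-- A bound for the `n`-th coefficient of `f ^ l` obtained by applying the derivation `X d/dX`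
twice. -/
lemma norm_nsmul_coeff_pow_le {f : A⟦X⟧} {n : ℕ} {K S Y : ℝ} (hK : 0 ≤ K) (hS : 0 ≤ S) (hY : 0 ≤ Y)
    (hf : ∀ l, ∑ m ∈ Finset.range (n + 1), ‖coeff m (f ^ l)‖ ≤ K)
    (hD : ∑ m ∈ Finset.range (n + 1), ‖coeff m (eulerD f)‖ ≤ Y)
    (hDS : ∀ m ≤ n, ‖coeff m (eulerD f)‖ ≤ S)
    (hDD : ∀ m ≤ n, ‖coeff m (eulerD (eulerD f))‖ ≤ Y) (l : ℕ) :
    ‖n • n • coeff n (f ^ l)‖ ≤ (2 * K ^ 3 * S + K ^ 2) * (l : ℝ) ^ 2 * Y := by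
  have hDpow : ∀ i ≤ l, ∑ m ∈ Finset.range (n + 1), ‖coeff m (eulerD (f ^ i))‖ ≤
      l * (K * Y * K) := fun i hi => by
    rw [eulerD_pow]
    calc _ ≤ ∑ m ∈ Finset.range (n + 1), ∑ j ∈ Finset.range i,
          ‖coeff m (f ^ j * eulerD f * f ^ (i - 1 - j))‖ := by
          refine Finset.sum_le_sum fun m _ => ?_
          rw [map_sum]
          exact norm_sum_le _ _
      _ = ∑ j ∈ Finset.range i, ∑ m ∈ Finset.range (n + 1),
          ‖coeff m (f ^ j * eulerD f * f ^ (i - 1 - j))‖ := Finset.sum_comm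
      _ ≤ ∑ j ∈ Finset.range i, K * Y * K := Finset.sum_le_sum fun j _ =>
          sum_norm_coeff_mul_le (sum_norm_coeff_mul_le (hf _) hD) (hf _)
      _ = i * (K * Y * K) := by rw [Finset.sum_const, Finset.card_range, nsmul_eq_mul]
      _ ≤ l * (K * Y * K) := by gcongr
  have hterm : ∀ i ∈ Finset.range l,
      ‖coeff n (eulerD (f ^ i * eulerD f * f ^ (l - 1 - i)))‖ ≤
        l * (K * Y * K) * S * K + K * Y * K + K * S * (l * (K * Y * K)) := fun i hi => by
    have hi' := Finset.mem_range.1 hi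
    have h1 := norm_coeff_mul_le_right (by positivity)
      (norm_coeff_mul_le_left hS (hDpow i (by omega)) hDS) (hf (l - 1 - i)) n le_rfl
    have h2 := norm_coeff_mul_le_right (by positivity)
      (norm_coeff_mul_le_left hY (hf i) hDD) (hf (l - 1 - i)) n le_rfl
    have h3 := norm_coeff_mul_le_right (by positivity)
      (norm_coeff_mul_le_left hS (hf i) hDS) (hDpow (l - 1 - i) (by omega)) n le_rfl
    rw [eulerD_mul, eulerD_mul, add_mul, map_add, map_add]
    exact norm_add_le_of_le (norm_add_le_of_le h1 h2) h3
  rw [← coeff_eulerD, ← coeff_eulerD, eulerD_pow, eulerD_sum, map_sum]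
  refine (norm_sum_le_of_le _ hterm).trans ?_
  rw [Finset.sum_const, Finset.card_range, nsmul_eq_mul]
  have hl : (l : ℝ) ≤ (l : ℝ) ^ 2 := by exact_mod_cast Nat.le_self_pow two_ne_zero l
  calc _ = 2 * K ^ 3 * S * (l : ℝ) ^ 2 * Y + K ^ 2 * l * Y := by ring
    _ ≤ 2 * K ^ 3 * S * (l : ℝ) ^ 2 * Y + K ^ 2 * (l : ℝ) ^ 2 * Y := by gcongr
    _ = _ := by ring

variable [NormedAlgebra ℂ A] {β : ℝ} {r τ : ℕ → ℝ} {R : ℕ → A} {u : ℕ → ℕ → A}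

lemma RegularTail.exists_norm_convolution_pow_le (h : RegularTail R r τ β) (hτ : Antitone τ)
    (hu0 : ∀ n, u 0 n = if n = 0 then 1 else 0)
    (hu : ∀ l n, u (l + 1) n = ∑ k ∈ Finset.range (n + 1), u l k * R (n - k)) {K : ℝ} (hK : 0 ≤ K)
    (huK : ∀ l n, ∑ m ∈ Finset.range n, ‖u l m‖ ≤ K) :
    ∃ C : ℝ, 0 ≤ C ∧ ∀ l n : ℕ, (n : ℝ) * ‖u l n‖ ≤ C * (l : ℝ) ^ 2 * τ n := by
  obtain ⟨C₁, hC₁, hsum⟩ := h.sum_le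
  obtain ⟨C₂, hC₂, hnorm⟩ := h.norm_le
  have hpos := h.pos
  have hns : ∀ (n : ℕ) (a : A), ‖n • a‖ = n * ‖a‖ := fun n a => by
    rw [← Nat.cast_smul_eq_nsmul ℂ, norm_smul, Complex.norm_natCast]
  set f : A⟦X⟧ := PowerSeries.mk R with hf
  have hpow : ∀ l n, coeff n (f ^ l) = u l n := fun l => by
    induction l with
    | zero => intro n; rw [pow_zero, coeff_one, hu0]
    | succ l ih =>
      intro n
      rw [pow_succ, coeff_mul, Finset.Nat.sum_antidiagonal_eq_sum_range_succ_mk, hu]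
      simp only [ih]
      simp only [hf, coeff_mk, Nat.succ_eq_add_one]
  have hD : ∀ m, ‖coeff m (eulerD f)‖ ≤ C₂ * τ m := fun m => by
    rw [coeff_eulerD, hf, coeff_mk, hns]
    exact hnorm m
  have hsum0 : ∀ n, ∑ m ∈ Finset.range (n + 1), ‖coeff m (eulerD f)‖ ≤ C₂ * (C₁ * n * τ n) := by
    intro n
    rw [Finset.range_eq_Ico, Finset.sum_eq_sum_Ico_succ_bot (by omega), coeff_eulerD, zero_smul,
      norm_zero, zero_add]
    calc _ ≤ ∑ m ∈ Finset.Icc 1 n, C₂ * τ m := Finset.sum_le_sum fun m _ => hD m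
      _ ≤ _ := by
        rw [← Finset.mul_sum]
        gcongr
        exact hsum n
  have hmul : ∀ m n : ℕ, m ≤ n → (m : ℝ) * τ m ≤ C₁ * n * τ n := fun m n hmn => by
    refine le_trans ?_ (hsum n)
    calc (m : ℝ) * τ m = ∑ j ∈ Finset.Icc 1 m, τ m := by simp
      _ ≤ ∑ j ∈ Finset.Icc 1 m, τ j :=
        Finset.sum_le_sum fun j hj => hτ (Finset.mem_Icc.1 hj).2
      _ ≤ ∑ j ∈ Finset.Icc 1 n, τ j :=
        Finset.sum_le_sum_of_subset_of_nonneg (Finset.Icc_subset_Icc_right hmn)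
          fun j _ _ => (hpos j).le
  have h0 := (hpos 0).le
  refine ⟨(2 * K ^ 3 * (C₂ * τ 0) + K ^ 2) * (C₂ * C₁), by positivity, fun l n => ?_⟩
  have hn0 := (hpos n).le
  rcases n.eq_zero_or_pos with rfl | hn
  · rw [Nat.cast_zero, zero_mul]
    positivity
  have key := norm_nsmul_coeff_pow_le (f := f) (n := n) hK (S := C₂ * τ 0)
    (Y := C₂ * (C₁ * n * τ n)) (by positivity) (by positivity) (fun l => by
      simpa only [hpow] using huK l (n + 1)) (hsum0 n)
    (fun m _ => (hD m).trans (by gcongr; exact hτ (Nat.zero_le m)))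
    (fun m hm => by
      rw [coeff_eulerD, hns]
      calc _ ≤ (m : ℝ) * (C₂ * τ m) := by
            gcongr
            exact hD m
        _ = C₂ * (m * τ m) := by ring
        _ ≤ _ := mul_le_mul_of_nonneg_left (hmul m n hm) hC₂.le) l
  rw [hns, hns, hpow] at key
  have hn' : (0 : ℝ) < n := by exact_mod_cast hn
  refine le_of_mul_le_mul_left (key.trans (le_of_eq ?_)) hn'
  ring

end SecondDerivative

/-- Uniform bound on the iterates of an aperiodic renewal sequence of operators. -/
theorem renewal_operator_iterate_bound
    {B : Type*} [NormedAddCommGroup B] [NormedSpace ℂ B] [CompleteSpace B]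
    (R : ℕ → B →L[ℂ] B) (hR0 : R 0 = 0)
    (hsum : Summable fun n => ‖R n‖)
    (Rtot : B →L[ℂ] B) (hRtot : Rtot = ∑' n, R n)
    -- (R1): a bounded projection Π with one-dimensional range, R Π = Π R = Π,
    -- and the spectral radius of R (I - Π) is < 1
    (Pi : B →L[ℂ] B) (hproj : Pi * Pi = Pi)
    (v : B) (hv : v ≠ 0)
    (hrange : LinearMap.range (Pi : B →ₗ[ℂ] B) = Submodule.span ℂ {v})
    (hRPi : Rtot * Pi = Pi) (hPiR : Pi * Rtot = Pi)
    (hspec1 : spectralRadius ℂ (Rtot * (1 - Pi)) < 1)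
    -- (R2): for z in the closed unit disk, z ≠ 1, the spectral radius of R(z) is < 1
    (hspec2 : ∀ z : ℂ, ‖z‖ ≤ 1 → z ≠ 1 →
      spectralRadius ℂ (∑' n, z ^ n • R n) < 1)
    -- (R3): Π R_n Π = r_n Π with r_n ≥ 0
    (r : ℕ → ℝ) (hrpos : ∀ n, 0 ≤ r n)
    (hrdef : ∀ n, Pi * R n * Pi = ((r n : ℂ) • Pi))
    (hrsum : Summable r)
    -- data of the theorem
    (β : ℝ) (hβ : β ∈ Set.Ioo (0 : ℝ) 1)
    (L : ℕ → ℝ) (hL : SlowlyVaryingSeq L)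
    -- (n^{1+β}/L(n)) R_n converges in operator norm to E
    (E : B →L[ℂ] B)
    (hconv : Tendsto
      (fun n : ℕ => ((((n : ℝ) ^ ((1 : ℝ) + β) / L n : ℝ) : ℂ)) • R n) atTop (nhds E))
    -- Σ_{j>n} r_j ∼ L(n)/n^β
    (htail : Tendsto
      (fun n : ℕ => (∑' j : ℕ, if n < j then r j else 0) * (n : ℝ) ^ β / L n)
      atTop (nhds 1)) :
    ∃ C : ℝ, 0 < C ∧ ∀ n : ℕ, 1 ≤ n → ∀ ℓ : ℕ, 1 ≤ ℓ →
      ‖opIter R ℓ n‖ ≤ C * ℓ ^ 2 * L n / (n : ℝ) ^ ((1 : ℝ) + β) := by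
  have hPi : Pi ≠ 0 := by
    rintro rfl
    have hmem : v ∈ LinearMap.range ((0 : B →L[ℂ] B) : B →ₗ[ℂ] B) :=
      hrange ▸ Submodule.mem_span_singleton_self v
    obtain ⟨w, hw⟩ := hmem
    exact hv hw.symm
  have hF0 : fourierSum R 0 = Rtot := by
    simp only [fourierSum, chr_at_zero, one_smul, hRtot]
  have hr : HasSum r 1 := by
    have h1 : HasSum (fun n => (r n : ℂ) • Pi) Pi := by
      have h := (hsum.of_norm.hasSum.mul_left Pi).mul_right Pi
      rw [← hRtot, hPiR, hproj] at h
      exact h.congr_fun fun n => (hrdef n).symm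
    have h2 : HasSum (fun n => (r n : ℂ) • Pi) (((∑' n, r n : ℝ) : ℂ) • Pi) :=
      (Complex.hasSum_ofReal.2 hrsum.hasSum).smul_const Pi
    have h3 : (((∑' n, r n : ℝ) : ℂ) - 1) • Pi = 0 := by
      rw [sub_smul, one_smul, h2.unique h1, sub_self]
    have h4 : ∑' n, r n = 1 := by
      exact_mod_cast sub_eq_zero.1 ((smul_eq_zero.1 h3).resolve_right hPi)
    exact h4 ▸ hrsum.hasSum
  simp only [tsum_ite_lt_eq_tailSum hrsum] at htail
  have hreg := regularTail hPi hsum hrpos hrdef hrsum hβ hL hconv htail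
  have hlocal : ∀ t, LocallyPowerBounded (fourierSum R) t := fun t => by
    by_cases ht : chr 1 t = 1
    · exact hreg.locallyPowerBounded hβ.1 hrpos hr hsum hproj (hF0.symm ▸ hRPi) (hF0.symm ▸ hPiR)
        hrdef (hF0.symm ▸ hspec1) ht
    · refine locallyPowerBounded_of_spectralRadius_lt_one hsum ?_
      simpa only [fourierSum, chr_natCast] using hspec2 (chr 1 t) (norm_chr 1 t).le ht
  have hu0 : ∀ n, opIter R 0 n = if n = 0 then 1 else 0 := fun n => rfl
  have hu : ∀ l n, opIter R (l + 1) n =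
      ∑ k ∈ Finset.range (n + 1), opIter R l k * R (n - k) := fun l n => rfl
  obtain ⟨K, hK, huK⟩ := sum_norm_convolution_pow_le hsum hu0 hu hlocal
  obtain ⟨C₁, hC₁, hbound⟩ := hreg.exists_norm_convolution_pow_le
    (antitone_tailSum hrsum hrpos) hu0 hu hK huK
  obtain ⟨C₂, hC₂, htailL⟩ := exists_forall_le_mul_of_eventually
    (f := fun n : ℕ => tailSum r n * (n : ℝ) ^ β) (C := 2) hL.1 <| by
      filter_upwards [htail.eventually (gt_mem_nhds one_lt_two)] with n hn
      exact ((div_lt_iff₀ (hL.1 n)).1 hn).le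
  refine ⟨(C₁ + 1) * C₂, by positivity, fun n hn l _ => ?_⟩
  have hn' : (0 : ℝ) < n := by exact_mod_cast hn
  have hLn := hL.1 n
  rw [le_div_iff₀ (by positivity), Real.rpow_add hn', Real.rpow_one]
  calc ‖opIter R l n‖ * (n * (n : ℝ) ^ β) = n * ‖opIter R l n‖ * (n : ℝ) ^ β := by ring
    _ ≤ C₁ * (l : ℝ) ^ 2 * tailSum r n * (n : ℝ) ^ β :=
        mul_le_mul_of_nonneg_right (hbound l n) (by positivity)
    _ = C₁ * (l : ℝ) ^ 2 * (tailSum r n * (n : ℝ) ^ β) := by ring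
    _ ≤ C₁ * (l : ℝ) ^ 2 * (C₂ * L n) := mul_le_mul_of_nonneg_left (htailL n) (by positivity)
    _ ≤ (C₁ + 1) * (l : ℝ) ^ 2 * (C₂ * L n) := by
        gcongr
        linarith
    _ = (C₁ + 1) * C₂ * (l : ℝ) ^ 2 * L n := by ring
end
end

section
/- Let (R_n)_{n≥1} be an aperiodic renewal sequence of operators on the complex Banach space 𝓑, let β ∈ (0,1) and let L : ℕ → (0,∞) be slowly varying. Assume that (n^{1+β}/L(n))·R_n converges in operator norm to a bounded operator E, and that Σ_{j>n} r_j ∼ L(n)/n^β as n → ∞. Then for every ℓ ≥ 1, the sequence (n^{1+β}/L(n))·R_n^{(ℓ)} converges in operator norm to the operator E_ℓ = Σ_{i=0}^{ℓ−1} R^i ∘ E ∘ R^{ℓ−1−i}, where R^i denotes the i-th iterate of R = R(1) (with R^0 = I). -/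
open Filter

noncomputable section

/-- One half of a convolution: the weight `g` is carried by the far factor `R (n - k)`. -/
theorem tendsto_smul_half_convolution {A : Type*} [NormedRing A] [NormedAlgebra ℂ A]
    [CompleteSpace A] {g : ℕ → ℝ} (hg0 : ∀ n, 0 ≤ g n)
    {C : ℝ} (hC : ∀ᶠ n in atTop, ∀ m, n ≤ 2 * m → m ≤ n → g n ≤ C * g m)
    (hshift : ∀ k, Tendsto (fun n => g n / g (n - k)) atTop (nhds 1))
    (hgpos : ∀ n, 1 ≤ n → 0 < g n)
    (μ : A →L[ℂ] A →L[ℂ] A) {S R : ℕ → A} (hS : Summable fun n => ‖S n‖) {E : A}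
    (hR : Tendsto (fun n => ((g n : ℝ) : ℂ) • R n) atTop (nhds E))
    (p : ℕ → ℕ → Prop) [∀ n k, Decidable (p n k)] (hp : ∀ n k, p n k → 2 * k ≤ n)
    (hp' : ∀ k, ∀ᶠ n in atTop, p n k) :
    Tendsto (fun n => ((g n : ℝ) : ℂ) •
        ∑ k ∈ (Finset.range (n + 1)).filter (p n), μ (S k) (R (n - k)))
      atTop (nhds (μ (∑' k, S k) E)) := by
  obtain ⟨M, hM⟩ := hR.norm.bddAbove_range
  replace hM : ∀ n, g n * ‖R n‖ ≤ M := fun n => by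
    have := hM ⟨n, rfl⟩
    simpa [norm_smul, abs_of_nonneg (hg0 n)] using this
  have hM0 : 0 ≤ M := (mul_nonneg (hg0 0) (norm_nonneg _)).trans (hM 0)
  have hlim : μ (∑' k, S k) E = ∑' k, μ (S k) E := by
    have hS' : Summable S := hS.of_norm
    have := ((μ.flip E).hasSum hS'.hasSum).tsum_eq
    simpa using this.symm
  have hsum_eq : ∀ n, ((g n : ℝ) : ℂ) •
        ∑ k ∈ (Finset.range (n + 1)).filter (p n), μ (S k) (R (n - k)) =
      ∑' k, if p n k then ((g n : ℝ) : ℂ) • μ (S k) (R (n - k)) else 0 := fun n => by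
    rw [tsum_eq_sum (s := Finset.range (n + 1)), Finset.smul_sum, Finset.sum_filter]
    intro k hk
    refine if_neg fun h => hk ?_
    have := hp n k h
    simp only [Finset.mem_range]
    omega
  simp only [hsum_eq, hlim]
  refine tendsto_tsum_of_dominated_convergence
    (bound := fun k => ‖μ‖ * ‖S k‖ * (|C| * M)) ((hS.mul_left _).mul_right _) ?_ ?_
  · intro k
    have hsh : Tendsto (fun n => ((g (n - k) : ℝ) : ℂ) • R (n - k)) atTop (nhds E) :=
      hR.comp (tendsto_sub_atTop_nat k)
    have hratio : Tendsto (fun n => ((g n / g (n - k) : ℝ) : ℂ)) atTop (nhds 1) := by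
      simpa [Function.comp_def] using (Complex.continuous_ofReal.tendsto 1).comp (hshift k)
    have hprod := ((μ (S k)).continuous.tendsto _).comp (hratio.smul hsh)
    rw [one_smul] at hprod
    refine hprod.congr' ?_
    filter_upwards [hp' k, eventually_gt_atTop k] with n hn hnk
    have hne : ((g (n - k) : ℝ) : ℂ) ≠ 0 := by
      exact_mod_cast (hgpos (n - k) (by omega)).ne'
    simp only [Function.comp_apply, if_pos hn]
    rw [smul_smul, Complex.ofReal_div, div_mul_cancel₀ _ hne, map_smul]
  · filter_upwards [hC] with n hn k
    split_ifs with hk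
    · have h2 := hp n k hk
      have hb : g n * ‖R (n - k)‖ ≤ |C| * M := calc
        g n * ‖R (n - k)‖ ≤ (C * g (n - k)) * ‖R (n - k)‖ := by
          gcongr
          exact hn _ (by omega) (by omega)
        _ = C * (g (n - k) * ‖R (n - k)‖) := by ring
        _ ≤ |C| * M := by
          gcongr
          · exact mul_nonneg (hg0 _) (norm_nonneg _)
          · exact le_abs_self C
          · exact hM _
      rw [norm_smul, Complex.norm_real, Real.norm_of_nonneg (hg0 n)]
      calc g n * ‖μ (S k) (R (n - k))‖ ≤ g n * (‖μ‖ * ‖S k‖ * ‖R (n - k)‖) := by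
            gcongr
            · exact hg0 n
            · exact μ.le_opNorm₂ _ _
        _ = ‖μ‖ * ‖S k‖ * (g n * ‖R (n - k)‖) := by ring
        _ ≤ _ := by gcongr
    · rw [norm_zero]
      positivity

/-- Weighted limits of convolutions of summable sequences, for a weight that is insensitive to
shifts and doubling. -/
theorem tendsto_smul_convolution {A : Type*} [NormedRing A] [NormedAlgebra ℂ A]
    [CompleteSpace A] {g : ℕ → ℝ} (hg0 : ∀ n, 0 ≤ g n)
    {C : ℝ} (hC : ∀ᶠ n in atTop, ∀ m, n ≤ 2 * m → m ≤ n → g n ≤ C * g m)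
    (hshift : ∀ k, Tendsto (fun n => g n / g (n - k)) atTop (nhds 1))
    (hgpos : ∀ n, 1 ≤ n → 0 < g n)
    {S R : ℕ → A} (hS : Summable fun n => ‖S n‖) (hRs : Summable fun n => ‖R n‖) {E F : A}
    (hSF : Tendsto (fun n => ((g n : ℝ) : ℂ) • S n) atTop (nhds F))
    (hRE : Tendsto (fun n => ((g n : ℝ) : ℂ) • R n) atTop (nhds E)) :
    Tendsto (fun n => ((g n : ℝ) : ℂ) • ∑ k ∈ Finset.range (n + 1), S k * R (n - k))
      atTop (nhds ((∑' k, S k) * E + F * ∑' k, R k)) := by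
  have h1 := tendsto_smul_half_convolution hg0 hC hshift hgpos (ContinuousLinearMap.mul ℂ A) hS hRE
    (fun n k => 2 * k ≤ n) (fun n k h => h) (fun k => eventually_ge_atTop _)
  have h2 := tendsto_smul_half_convolution hg0 hC hshift hgpos (ContinuousLinearMap.mul ℂ A).flip
    hRs hSF (fun n k => 2 * k < n) (fun n k h => h.le) (fun k => eventually_gt_atTop _)
  simp only [ContinuousLinearMap.flip_apply, ContinuousLinearMap.mul_apply'] at h1 h2
  refine (h1.add h2).congr fun n => ?_
  rw [← smul_add]
  congr 1
  rw [← Finset.sum_filter_add_sum_filter_not (Finset.range (n + 1)) (fun k => 2 * k ≤ n)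
    (fun k => S k * R (n - k))]
  congr 1
  refine Finset.sum_nbij' (fun k => n - k) (fun k => n - k) ?_ ?_ ?_ ?_ ?_
  · intro k hk
    simp only [Finset.mem_filter, Finset.mem_range] at hk ⊢
    omega
  · intro k hk
    simp only [Finset.mem_filter, Finset.mem_range] at hk ⊢
    omega
  · intro k hk
    simp only [Finset.mem_filter, Finset.mem_range] at hk
    omega
  · intro k hk
    simp only [Finset.mem_filter, Finset.mem_range] at hk
    omega
  · intro k hk
    simp only [Finset.mem_filter, Finset.mem_range] at hk
    rw [Nat.sub_sub_self (by omega)]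

/-- A monotone regularly varying sequence is asymptotically invariant under shifts. -/
theorem Monotone.tendsto_div_sub_of_floor {g : ℕ → ℝ} (hg : Monotone g)
    (hgpos : ∀ n, 1 ≤ n → 0 < g n) {α : ℝ}
    (hreg : ∀ c : ℝ, 0 < c → Tendsto (fun n : ℕ => g ⌊c * n⌋₊ / g n) atTop (nhds (c ^ α)))
    (k : ℕ) : Tendsto (fun n => g n / g (n - k)) atTop (nhds 1) := by
  have key : Tendsto (fun n => g (n - k) / g n) atTop (nhds 1) := by
    refine tendsto_order.2 ⟨fun b hb => ?_, fun b hb => ?_⟩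
    · have hcont : Tendsto (fun c : ℝ => c ^ α) (nhdsWithin 1 (Set.Iio 1)) (nhds 1) := by
        have := (Real.continuousAt_rpow_const 1 α (Or.inl one_ne_zero)).tendsto
        rw [Real.one_rpow] at this
        exact this.mono_left nhdsWithin_le_nhds
      have hpos : ∀ᶠ c : ℝ in nhdsWithin 1 (Set.Iio 1), 0 < c :=
        nhdsWithin_le_nhds (lt_mem_nhds one_pos)
      obtain ⟨c, hbc, hc0, hc1⟩ :=
        ((hcont.eventually (lt_mem_nhds hb)).and (hpos.and self_mem_nhdsWithin)).exists
      have hc1 : c < 1 := hc1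
      have hlarge : ∀ᶠ n : ℕ in atTop, (k : ℝ) ≤ (1 - c) * n :=
        (tendsto_natCast_atTop_atTop.const_mul_atTop (sub_pos.2 hc1)).eventually_ge_atTop _
      filter_upwards [(hreg c hc0).eventually (lt_mem_nhds hbc), hlarge, eventually_ge_atTop 1,
        eventually_ge_atTop k] with n hn hkn h1 hk
      refine hn.trans_le ?_
      have := hgpos n h1
      gcongr
      apply hg
      refine Nat.floor_le_of_le ?_
      rw [Nat.cast_sub hk]
      linarith
    · filter_upwards [eventually_ge_atTop 1] with n h1
      exact ((div_le_one (hgpos n h1)).2 (hg (Nat.sub_le n k))).trans_lt hb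
  simpa using key.inv₀ one_ne_zero

/-- A monotone regularly varying sequence has the doubling property. -/
theorem Monotone.eventually_le_mul_of_floor {g : ℕ → ℝ} (hg : Monotone g)
    (hgpos : ∀ n, 1 ≤ n → 0 < g n) {α : ℝ}
    (hreg : ∀ c : ℝ, 0 < c → Tendsto (fun n : ℕ => g ⌊c * n⌋₊ / g n) atTop (nhds (c ^ α))) :
    ∃ C : ℝ, ∀ᶠ n in atTop, ∀ m, n ≤ 2 * m → m ≤ n → g n ≤ C * g m := by
  have hpos : (0 : ℝ) < (1 / 2 : ℝ) ^ α := by positivity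
  obtain ⟨d, hd0, hd⟩ := exists_between hpos
  refine ⟨d⁻¹, ?_⟩
  filter_upwards [(hreg (1 / 2) (by norm_num)).eventually (lt_mem_nhds hd),
    eventually_ge_atTop 1] with n hn h1 m hm _
  rw [lt_div_iff₀ (hgpos n h1)] at hn
  have hle : g ⌊(1 / 2 : ℝ) * n⌋₊ ≤ g m := by
    apply hg
    refine Nat.floor_le_of_le ?_
    have : (n : ℝ) ≤ 2 * m := by exact_mod_cast hm
    linarith
  rw [inv_mul_eq_div, le_div_iff₀ hd0]
  linarith

/-- The weights `n ^ α / L n` with `L` slowly varying are regularly varying of index `α`. -/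
theorem SlowlyVaryingSeq.tendsto_rpow_div_floor {L : ℕ → ℝ} (hL : SlowlyVaryingSeq L) (α : ℝ)
    {c : ℝ} (hc : 0 < c) :
    Tendsto (fun n : ℕ => ((⌊c * n⌋₊ : ℝ) ^ α / L ⌊c * n⌋₊) / ((n : ℝ) ^ α / L n))
      atTop (nhds (c ^ α)) := by
  have hfl : Tendsto (fun n : ℕ => (⌊c * n⌋₊ : ℝ) / n) atTop (nhds c) :=
    (tendsto_nat_floor_mul_div_atTop hc.le).comp tendsto_natCast_atTop_atTop
  have h1 := hfl.rpow_const (p := α) (Or.inl hc.ne')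
  have h2 := (hL.2 c hc).inv₀ one_ne_zero
  have h3 := h1.mul h2
  rw [inv_one, mul_one] at h3
  refine h3.congr fun n => ?_
  rw [Real.div_rpow (Nat.cast_nonneg _) (Nat.cast_nonneg _), inv_div, div_div_div_eq,
    div_mul_div_comm, mul_comm (L _)]

/-- Iterated convolutions are absolutely summable, with sum the power of the total sum. -/
theorem summable_norm_opIter_and_tsum {B : Type*} [NormedAddCommGroup B] [NormedSpace ℂ B]
    [CompleteSpace B] {R : ℕ → B →L[ℂ] B} (hR : Summable fun n => ‖R n‖) (ℓ : ℕ) :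
    (Summable fun n => ‖opIter R ℓ n‖) ∧ ∑' n, opIter R ℓ n = (∑' n, R n) ^ ℓ := by
  induction ℓ with
  | zero =>
    constructor
    · refine summable_of_ne_finset_zero (s := {0}) fun n hn => ?_
      simp only [Finset.mem_singleton] at hn
      simp [opIter, hn]
    · simp [opIter]
  | succ ℓ ih =>
    refine ⟨summable_norm_sum_mul_range_of_summable_norm ih.1 hR, ?_⟩
    rw [pow_succ, ← ih.2, tsum_mul_tsum_eq_tsum_sum_range_of_summable_norm ih.1 hR]
    rfl

/-- Weighted limits of the iterated convolutions `opIter R ℓ`. -/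
theorem tendsto_smul_opIter {B : Type*} [NormedAddCommGroup B] [NormedSpace ℂ B]
    [CompleteSpace B] {g : ℕ → ℝ} (hg0 : ∀ n, 0 ≤ g n)
    {C : ℝ} (hC : ∀ᶠ n in atTop, ∀ m, n ≤ 2 * m → m ≤ n → g n ≤ C * g m)
    (hshift : ∀ k, Tendsto (fun n => g n / g (n - k)) atTop (nhds 1))
    (hgpos : ∀ n, 1 ≤ n → 0 < g n)
    {R : ℕ → B →L[ℂ] B} (hR : Summable fun n => ‖R n‖) {E : B →L[ℂ] B}
    (hRE : Tendsto (fun n => ((g n : ℝ) : ℂ) • R n) atTop (nhds E)) (ℓ : ℕ) :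
    Tendsto (fun n => ((g n : ℝ) : ℂ) • opIter R ℓ n) atTop
      (nhds (∑ i ∈ Finset.range ℓ, (∑' n, R n) ^ i * E * (∑' n, R n) ^ (ℓ - 1 - i))) := by
  induction ℓ with
  | zero =>
    rw [Finset.sum_range_zero]
    refine tendsto_const_nhds.congr' ?_
    filter_upwards [eventually_gt_atTop 0] with n hn
    simp [opIter, hn.ne']
  | succ ℓ ih =>
    obtain ⟨hs, ht⟩ := summable_norm_opIter_and_tsum hR ℓ
    have h := tendsto_smul_convolution hg0 hC hshift hgpos hs hR ih hRE
    have hlim : (∑' n, opIter R ℓ n) * E +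
          (∑ i ∈ Finset.range ℓ, (∑' n, R n) ^ i * E * (∑' n, R n) ^ (ℓ - 1 - i)) * ∑' n, R n =
        ∑ i ∈ Finset.range (ℓ + 1), (∑' n, R n) ^ i * E * (∑' n, R n) ^ (ℓ + 1 - 1 - i) := by
      rw [ht, Finset.sum_range_succ, add_comm, Finset.sum_mul]
      congr 1
      · refine Finset.sum_congr rfl fun i hi => ?_
        rw [Finset.mem_range] at hi
        rw [mul_assoc, ← pow_succ]
        congr 2
        omega
      · simp
    rw [hlim] at h
    exact h

/-- Convergence of the iterates of an aperiodic renewal sequence of operators. -/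
theorem renewal_operator_iterate_conv
    {B : Type*} [NormedAddCommGroup B] [NormedSpace ℂ B] [CompleteSpace B]
    (R : ℕ → B →L[ℂ] B) (hR0 : R 0 = 0)
    (hsum : Summable fun n => ‖R n‖)
    (Rtot : B →L[ℂ] B) (hRtot : Rtot = ∑' n, R n)
    -- (R1): a bounded projection Π with one-dimensional range, R Π = Π R = Π,
    -- and the spectral radius of R (I - Π) is < 1
    (Pi : B →L[ℂ] B) (hproj : Pi * Pi = Pi)
    (v : B) (hv : v ≠ 0)
    (hrange : LinearMap.range (Pi : B →ₗ[ℂ] B) = Submodule.span ℂ {v})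
    (hRPi : Rtot * Pi = Pi) (hPiR : Pi * Rtot = Pi)
    (hspec1 : spectralRadius ℂ (Rtot * (1 - Pi)) < 1)
    -- (R2): for z in the closed unit disk, z ≠ 1, the spectral radius of R(z) is < 1
    (hspec2 : ∀ z : ℂ, ‖z‖ ≤ 1 → z ≠ 1 →
      spectralRadius ℂ (∑' n, z ^ n • R n) < 1)
    -- (R3): Π R_n Π = r_n Π with r_n ≥ 0
    (r : ℕ → ℝ) (hrpos : ∀ n, 0 ≤ r n)
    (hrdef : ∀ n, Pi * R n * Pi = ((r n : ℂ) • Pi))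
    (hrsum : Summable r)
    -- data of the theorem
    (β : ℝ) (hβ : β ∈ Set.Ioo (0 : ℝ) 1)
    (L : ℕ → ℝ) (hL : SlowlyVaryingSeq L)
    -- (n^{1+β}/L(n)) R_n converges in operator norm to E
    (E : B →L[ℂ] B)
    (hconv : Tendsto
      (fun n : ℕ => ((((n : ℝ) ^ ((1 : ℝ) + β) / L n : ℝ) : ℂ)) • R n) atTop (nhds E))
    -- Σ_{j>n} r_j ∼ L(n)/n^β
    (htail : Tendsto
      (fun n : ℕ => (∑' j : ℕ, if n < j then r j else 0) * (n : ℝ) ^ β / L n)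
      atTop (nhds 1)) :
    ∀ ℓ : ℕ, 1 ≤ ℓ →
      Tendsto (fun n : ℕ => ((((n : ℝ) ^ ((1 : ℝ) + β) / L n : ℝ) : ℂ)) • opIter R ℓ n)
        atTop (nhds (∑ i ∈ Finset.range ℓ, Rtot ^ i * E * Rtot ^ (ℓ - 1 - i))) := by
  intro ℓ _
  have hLpos := hL.1
  set T : ℕ → ℝ := fun n => ∑' j : ℕ, if n < j then r j else 0 with hT
  set a : ℕ → ℝ := fun n => (n : ℝ) ^ ((1 : ℝ) + β) / L n with ha
  set q : ℕ → ℝ := fun n => T n * (n : ℝ) ^ β / L n with hq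
  have hTs : ∀ n, Summable fun j : ℕ => if n < j then r j else 0 := fun n =>
    Summable.of_nonneg_of_le (fun j => by split_ifs <;> simp [hrpos])
      (fun j => by split_ifs <;> simp [hrpos]) hrsum
  have hTanti : Antitone T := fun m n hmn =>
    (hTs n).tsum_le_tsum (fun j => by
      split_ifs with h1 h2
      · exact le_rfl
      · exact absurd (hmn.trans_lt h1) h2
      · exact hrpos j
      · exact le_rfl) (hTs m)
  have hTpos : ∀ n, 0 < T n := fun n => by
    obtain ⟨m, hm, hnm⟩ :=
      ((htail.eventually (lt_mem_nhds one_pos)).and (eventually_ge_atTop n)).exists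
    refine lt_of_lt_of_le ?_ (hTanti hnm)
    by_contra! h
    have : T m * (m : ℝ) ^ β / L m ≤ 0 :=
      div_nonpos_of_nonpos_of_nonneg
        (mul_nonpos_of_nonpos_of_nonneg h (by positivity)) (hLpos m).le
    exact absurd hm this.not_gt
  set g : ℕ → ℝ := fun n => n / T n with hgdef
  have hg0 : ∀ n, 0 ≤ g n := fun n => div_nonneg (Nat.cast_nonneg n) (hTpos n).le
  have hgpos : ∀ n, 1 ≤ n → 0 < g n := fun n hn =>
    div_pos (by exact_mod_cast hn) (hTpos n)
  have hgmono : Monotone g := fun m n hmn =>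
    div_le_div₀ (Nat.cast_nonneg n) (by exact_mod_cast hmn) (hTpos n) (hTanti hmn)
  have haq : ∀ n, a n = q n * g n := fun n => by
    have h1 := (hTpos n).ne'
    have h2 := (hLpos n).ne'
    have h3 : (n : ℝ) ^ ((1 : ℝ) + β) = n * (n : ℝ) ^ β := by
      rw [Real.rpow_add' (Nat.cast_nonneg n) (by linarith [hβ.1]), Real.rpow_one]
    simp only [ha, hq, hgdef, h3]
    field_simp
  have hqinv : Tendsto (fun n => (q n)⁻¹) atTop (nhds 1) := by
    simpa using htail.inv₀ one_ne_zero
  have hqne : ∀ᶠ n in atTop, q n ≠ 0 := htail.eventually_ne one_ne_zero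
  have hreg : ∀ c : ℝ, 0 < c →
      Tendsto (fun n : ℕ => g ⌊c * n⌋₊ / g n) atTop (nhds (c ^ ((1 : ℝ) + β))) := by
    intro c hc
    have hfl : Tendsto (fun n : ℕ => ⌊c * n⌋₊) atTop atTop :=
      tendsto_nat_floor_atTop.comp (tendsto_natCast_atTop_atTop.const_mul_atTop hc)
    have h := (hL.tendsto_rpow_div_floor ((1 : ℝ) + β) hc).mul
      ((hqinv.comp hfl).mul htail)
    rw [one_mul, mul_one] at h
    refine h.congr' ?_
    filter_upwards [hqne, hfl.eventually hqne, eventually_ge_atTop 1] with n h1 h2 h3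
    have h4 := (hgpos n h3).ne'
    change a ⌊c * n⌋₊ / a n * ((q ⌊c * n⌋₊)⁻¹ * q n) = _
    rw [haq, haq]
    field_simp
  have hgR : Tendsto (fun n => ((g n : ℝ) : ℂ) • R n) atTop (nhds E) := by
    have h := ((Complex.continuous_ofReal.tendsto 1).comp hqinv).smul hconv
    rw [Complex.ofReal_one, one_smul] at h
    refine h.congr' ?_
    filter_upwards [hqne] with n hn
    change (((q n)⁻¹ : ℝ) : ℂ) • ((a n : ℝ) : ℂ) • R n = _
    rw [smul_smul, ← Complex.ofReal_mul, haq, inv_mul_cancel_left₀ hn]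
  obtain ⟨C, hC⟩ := hgmono.eventually_le_mul_of_floor hgpos hreg
  have hmain := tendsto_smul_opIter hg0 hC (hgmono.tendsto_div_sub_of_floor hgpos hreg) hgpos
    hsum hgR ℓ
  have h := ((Complex.continuous_ofReal.tendsto 1).comp htail).smul hmain
  rw [Complex.ofReal_one, one_smul, ← hRtot] at h
  refine h.congr fun n => ?_
  change ((q n : ℝ) : ℂ) • ((g n : ℝ) : ℂ) • opIter R ℓ n = ((a n : ℝ) : ℂ) • _
  rw [smul_smul, ← Complex.ofReal_mul, haq]
end
end
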